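/- There exist universal constants c₁, c₂ > 0 with the following property. Let n ≥ 1 be an integer, H > 0, ε, δ ∈ (0,1), let 𝒳 be a collection of subsets of {1,…,n} with ∅ ∈ 𝒳, and let F = F₁ ⊗ … ⊗ F_n be a product probability measure on ℝⁿ whose marginals F_i are atomless and supported in [0,H]. Then there exist an integer t ≤ c₁·H·n²/ε, a nondecreasing vector Φ ∈ ℝᵗ, and a strict total order on 𝒳 such that for every m ≥ c₂·(H·n/ε)²·(n·t·ln(n·t+2)·(1+ln(H·n/ε + 1)) + ln(1/δ)), with probability at least 1 − δ over an i.i.d. sample v¹,…,vᵐ from F, every t-level auction Â for 𝒳 (with that Φ and tie-breaking order) that maximizes Σ_{j=1}^m Rev_A(vʲ) over all such auctions A satisfies E_{v∼F}[Rev_Â(v)] ≥ OPT_𝒳(F) − ε. -/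

import Mathlib

open MeasureTheory
open scoped ENNReal

attribute [local instance] Classical.propDecidable

/-- A `t`-level auction's thresholds for `n` bidders: nondecreasing thresholds
`thr i 0 ≤ thr i 1 ≤ … ≤ thr i (t-1)` for each bidder `i`. -/
structure TLevel (n t : ℕ) where
  thr : Fin n → Fin t → ℝ
  mono : ∀ i, Monotone (thr i)

/-- The number of thresholds of bidder `i` met by bid `b`.  Since the thresholds are
nondecreasing, bidder `i`'s level is this count minus one (and `-1`, i.e. count `0`,
means no threshold is met). -/
noncomputable def levCount {n t : ℕ} (A : TLevel n t) (i : Fin n) (b : ℝ) : ℕ :=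
  (Finset.univ.filter fun τ : Fin t => A.thr i τ ≤ b).card

/-- The estimate `Φ_τ` attached to a bidder whose met-threshold count is `c`
(i.e. whose level is `τ = c - 1`); junk value `0` out of range. -/
noncomputable def phiAt {t : ℕ} (Φ : Fin t → ℝ) (c : ℕ) : ℝ :=
  if h : c - 1 < t then Φ ⟨c - 1, h⟩ else 0

/-- `e_X(v) = Σ_{i ∈ X} Φ_{t_i(v_i)}`: the estimated virtual value of the feasible
set `X` at profile `v`. -/
noncomputable def eSet {n t : ℕ} (A : TLevel n t) (Φ : Fin t → ℝ)
    (v : Fin n → ℝ) (X : Finset (Fin n)) : ℝ :=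
  ∑ i ∈ X, phiAt Φ (levCount A i (v i))

/-- The set selected by the `t`-level auction for the feasibility system `𝒳` with
estimates `Φ` and tie-breaking order `ord` on `𝒳`: if some bidder has level `-1`,
select `∅`; otherwise select the member of `𝒳` maximizing `e_X(v)`, ties broken
by `ord`. -/
noncomputable def selected {n t : ℕ} (A : TLevel n t) (Φ : Fin t → ℝ)
    (𝒳 : Finset (Finset (Fin n))) (ord : Finset (Fin n) → Finset (Fin n) → Prop)
    (v : Fin n → ℝ) : Finset (Fin n) :=
  if ∃ i, levCount A i (v i) = 0 then ∅
  else if h : ∃ X, X ∈ 𝒳 ∧ ∀ Y ∈ 𝒳, Y ≠ X →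
      (eSet A Φ v Y < eSet A Φ v X ∨ (eSet A Φ v Y = eSet A Φ v X ∧ ord X Y)) then
    h.choose
  else ∅

/-- The payment of a selected bidder `i`: the infimum over bids at which `i` would
still belong to the selected set (unselected bidders pay 0 in `RevX` below). -/
noncomputable def payX {n t : ℕ} (A : TLevel n t) (Φ : Fin t → ℝ)
    (𝒳 : Finset (Finset (Fin n))) (ord : Finset (Fin n) → Finset (Fin n) → Prop)
    (v : Fin n → ℝ) (i : Fin n) : ℝ :=
  sInf {b : ℝ | i ∈ selected A Φ 𝒳 ord (Function.update v i b)}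

/-- The revenue of the `t`-level auction for `𝒳` on profile `v`: the sum of the
selected bidders' critical payments. -/
noncomputable def RevX {n t : ℕ} (A : TLevel n t) (Φ : Fin t → ℝ)
    (𝒳 : Finset (Finset (Fin n))) (ord : Finset (Fin n) → Finset (Fin n) → Prop)
    (v : Fin n → ℝ) : ℝ :=
  ∑ i ∈ selected A Φ 𝒳 ord v, payX A Φ 𝒳 ord v i

/-- `ord` is a strict total order on the members of `𝒳`. -/
def StrictTotalOn {n : ℕ} (𝒳 : Finset (Finset (Fin n)))
    (ord : Finset (Fin n) → Finset (Fin n) → Prop) : Prop :=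
  (∀ X ∈ 𝒳, ¬ ord X X) ∧
  (∀ X ∈ 𝒳, ∀ Y ∈ 𝒳, ∀ Z ∈ 𝒳, ord X Y → ord Y Z → ord X Z) ∧
  (∀ X ∈ 𝒳, ∀ Y ∈ 𝒳, X ≠ Y → ord X Y ∨ ord Y X)

/-- A deterministic DSIC-IR auction for the feasibility system `𝒳` with valuations in
`V`: a measurable allocation rule choosing a feasible set, and measurable nonnegative
payments bounded by value times allocation, such that truthful bidding is a dominant
strategy. -/
structure XDSICAuction (n : ℕ) (𝒳 : Finset (Finset (Fin n))) (V : Set ℝ) where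
  choice : (Fin n → ℝ) → Finset (Fin n)
  pay : (Fin n → ℝ) → Fin n → ℝ
  choice_mem : ∀ v, choice v ∈ 𝒳
  choice_meas : ∀ X : Finset (Fin n), MeasurableSet {v | choice v = X}
  pay_meas : ∀ i, Measurable fun v => pay v i
  pay_nonneg : ∀ v i, 0 ≤ pay v i
  pay_le : ∀ v, (∀ j, v j ∈ V) → ∀ i,
    pay v i ≤ v i * (if i ∈ choice v then 1 else 0)
  dsic : ∀ v : Fin n → ℝ, (∀ j, v j ∈ V) → ∀ (i : Fin n) (b : ℝ), b ∈ V →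
    v i * (if i ∈ choice (Function.update v i b) then 1 else 0) -
        pay (Function.update v i b) i ≤
      v i * (if i ∈ choice v then 1 else 0) - pay v i

/-- `OPTX n 𝒳 V F`: the supremum of expected revenue over all DSIC-IR auctions for
the feasibility system `𝒳` with valuations in `V`, for bid distribution `F`. -/
noncomputable def OPTX (n : ℕ) (𝒳 : Finset (Finset (Fin n))) (V : Set ℝ)
    (F : Measure (Fin n → ℝ)) : ℝ≥0∞ :=
  ⨆ A : XDSICAuction n 𝒳 V, ∫⁻ v, ∑ i, ENNReal.ofReal (A.pay v i) ∂F

/-- A fixed strict total order on the sets of bidders, used to break ties. -/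
noncomputable def tieOrd {n : ℕ} (X Y : Finset (Fin n)) : Prop :=
  Fintype.equivFin (Finset (Fin n)) X < Fintype.equivFin (Finset (Fin n)) Y

lemma strictTotalOn_tieOrd {n : ℕ} (𝒳 : Finset (Finset (Fin n))) :
    StrictTotalOn 𝒳 (tieOrd (n := n)) := by
  refine ⟨fun X _ => lt_irrefl _, fun X _ Y _ Z _ => lt_trans, fun X _ Y _ h => ?_⟩
  exact lt_or_gt_of_ne fun h' => h ((Fintype.equivFin _).injective h')

/-- `X` has larger score than `Y`, or the same score and precedence in the tie-breaking order. -/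
def Beats {n : ℕ} (e : Finset (Fin n) → ℝ) (X Y : Finset (Fin n)) : Prop :=
  e Y < e X ∨ (e Y = e X ∧ tieOrd X Y)

lemma Beats.asymm {n : ℕ} {e : Finset (Fin n) → ℝ} {X Y : Finset (Fin n)}
    (h : Beats e X Y) : ¬ Beats e Y X := by
  rintro (h' | ⟨h', h2⟩) <;> rcases h with h | ⟨h, h1⟩
  · linarith
  · linarith
  · linarith
  · exact lt_asymm h1 h2

lemma exists_beats_all {n : ℕ} {𝒳 : Finset (Finset (Fin n))} (h𝒳 : 𝒳.Nonempty)
    (e : Finset (Fin n) → ℝ) :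
    ∃ X, X ∈ 𝒳 ∧ ∀ Y ∈ 𝒳, Y ≠ X → Beats e X Y := by
  obtain ⟨X, hX, hmax⟩ := 𝒳.exists_max_image
    (fun X => toLex (e X, OrderDual.toDual (Fintype.equivFin (Finset (Fin n)) X))) h𝒳
  refine ⟨X, hX, fun Y hY hYX => ?_⟩
  have h := hmax Y hY
  rw [Prod.Lex.toLex_le_toLex] at h
  rcases h with h | ⟨h, h'⟩
  · exact Or.inl h
  · refine Or.inr ⟨h, lt_of_le_of_ne (OrderDual.toDual_le_toDual.1 h') fun h'' => ?_⟩
    exact hYX ((Fintype.equivFin _).injective h'').symm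

/-- The set selected when bidder `i` meets `c i` thresholds. -/
noncomputable def chosen {n t : ℕ} (Φ : Fin t → ℝ) (𝒳 : Finset (Finset (Fin n)))
    (c : Fin n → ℕ) : Finset (Fin n) :=
  if ∃ i, c i = 0 then ∅
  else if h : ∃ X, X ∈ 𝒳 ∧ ∀ Y ∈ 𝒳, Y ≠ X → Beats (fun X => ∑ i ∈ X, phiAt Φ (c i)) X Y then
    h.choose
  else ∅

/-- The vector of numbers of thresholds met. -/
noncomputable def levels {n t : ℕ} (A : TLevel n t) (v : Fin n → ℝ) : Fin n → ℕ :=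
  fun i => levCount A i (v i)

lemma selected_eq_chosen {n t : ℕ} (A : TLevel n t) (Φ : Fin t → ℝ)
    (𝒳 : Finset (Finset (Fin n))) (v : Fin n → ℝ) :
    selected A Φ 𝒳 tieOrd v = chosen Φ 𝒳 (levels A v) := by
  simp only [selected, chosen, eSet, levels, Beats]
  congr

section Chosen

variable {n t : ℕ} {Φ : Fin t → ℝ} {𝒳 : Finset (Finset (Fin n))} {c : Fin n → ℕ}

lemma chosen_spec (h𝒳 : ∅ ∈ 𝒳) (hc : ∀ i, c i ≠ 0) :
    chosen Φ 𝒳 c ∈ 𝒳 ∧ ∀ Y ∈ 𝒳, Y ≠ chosen Φ 𝒳 c →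
      Beats (fun X => ∑ i ∈ X, phiAt Φ (c i)) (chosen Φ 𝒳 c) Y := by
  have h := exists_beats_all ⟨∅, h𝒳⟩ (fun X => ∑ i ∈ X, phiAt Φ (c i))
  have h1 : chosen Φ 𝒳 c = h.choose := by
    rw [chosen, if_neg (by simpa using hc), dif_pos h]
  rw [h1]
  exact h.choose_spec

lemma ne_zero_of_mem_chosen {i : Fin n} (hi : i ∈ chosen Φ 𝒳 c) (j : Fin n) : c j ≠ 0 := by
  intro h
  rw [chosen, if_pos ⟨j, h⟩] at hi
  simp at hi

lemma sum_le_sum_chosen (h𝒳 : ∅ ∈ 𝒳) (hc : ∀ i, c i ≠ 0) {Y : Finset (Fin n)} (hY : Y ∈ 𝒳) :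
    ∑ i ∈ Y, phiAt Φ (c i) ≤ ∑ i ∈ chosen Φ 𝒳 c, phiAt Φ (c i) := by
  by_cases h : Y = chosen Φ 𝒳 c
  · rw [← h]
  · rcases (chosen_spec (Φ := Φ) h𝒳 hc).2 Y hY h with h' | ⟨h', -⟩
    · exact h'.le
    · exact h'.le

lemma phiAt_le_phiAt (hΦ : Monotone Φ) {k l : ℕ} (hkl : k ≤ l) (hl : l ≤ t) (hk : k ≠ 0) :
    phiAt Φ k ≤ phiAt Φ l := by
  have h1 : k - 1 < t := by omega
  have h2 : l - 1 < t := by omega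
  rw [phiAt, phiAt, dif_pos h1, dif_pos h2]
  exact hΦ (Fin.mk_le_mk.2 (by omega))

lemma mem_chosen_update (h𝒳 : ∅ ∈ 𝒳) (hΦ : Monotone Φ) {i : Fin n} (hi : i ∈ chosen Φ 𝒳 c)
    {k : ℕ} (hk : c i ≤ k) (hkt : k ≤ t) : i ∈ chosen Φ 𝒳 (Function.update c i k) := by
  by_contra hi'
  have hc := ne_zero_of_mem_chosen hi
  have hc' : ∀ j, Function.update c i k j ≠ 0 := by
    intro j
    by_cases hj : j = i
    · subst hj
      have := hc j
      simp
      omega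
    · simp [hj, hc j]
  set X := chosen Φ 𝒳 c
  set X' := chosen Φ 𝒳 (Function.update c i k)
  have hne : X ≠ X' := fun h => hi' (h ▸ hi)
  have h1 := (chosen_spec (Φ := Φ) h𝒳 hc).2 X' (chosen_spec h𝒳 hc').1 hne.symm
  have h2 := (chosen_spec (Φ := Φ) h𝒳 hc').2 X (chosen_spec h𝒳 hc).1 hne
  have e1 : ∑ j ∈ X', phiAt Φ (Function.update c i k j) = ∑ j ∈ X', phiAt Φ (c j) := by
    refine Finset.sum_congr rfl fun j hj => ?_
    rw [Function.update_of_ne]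
    rintro rfl
    exact hi' hj
  have e2 : ∑ j ∈ X, phiAt Φ (c j) ≤ ∑ j ∈ X, phiAt Φ (Function.update c i k j) := by
    refine Finset.sum_le_sum fun j hj => ?_
    by_cases hji : j = i
    · subst hji
      simpa using phiAt_le_phiAt hΦ hk hkt (hc j)
    · simp [hji]
  refine Beats.asymm h2 ?_
  rcases h1 with h1 | ⟨h1, h1'⟩
  · left
    simp only at h1 ⊢
    linarith
  · rcases e2.lt_or_eq with e2 | e2
    · left
      simp only at h1 ⊢
      linarith
    · right
      simp only at h1 ⊢
      exact ⟨by linarith, h1'⟩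

/-- The least number of thresholds bidder `i` has to meet in order to be selected. -/
noncomputable def crit (Φ : Fin t → ℝ) (𝒳 : Finset (Finset (Fin n))) (c : Fin n → ℕ)
    (i : Fin n) : ℕ :=
  sInf {k | i ∈ chosen Φ 𝒳 (Function.update c i k)}

lemma mem_chosen_update_crit {i : Fin n} {k : ℕ}
    (hi : i ∈ chosen Φ 𝒳 (Function.update c i k)) :
    i ∈ chosen Φ 𝒳 (Function.update c i (crit Φ 𝒳 c i)) :=
  Nat.sInf_mem (s := {k | i ∈ chosen Φ 𝒳 (Function.update c i k)}) ⟨k, hi⟩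

lemma crit_le {i : Fin n} {k : ℕ}
    (hi : i ∈ chosen Φ 𝒳 (Function.update c i k)) : crit Φ 𝒳 c i ≤ k :=
  Nat.sInf_le hi

lemma crit_ne_zero {i : Fin n} {k : ℕ}
    (hi : i ∈ chosen Φ 𝒳 (Function.update c i k)) : crit Φ 𝒳 c i ≠ 0 := by
  simpa using ne_zero_of_mem_chosen (mem_chosen_update_crit hi) i

lemma mem_chosen_update_iff (h𝒳 : ∅ ∈ 𝒳) (hΦ : Monotone Φ) {i : Fin n} {k l : ℕ}
    (hi : i ∈ chosen Φ 𝒳 (Function.update c i k)) (hl : l ≤ t) :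
    i ∈ chosen Φ 𝒳 (Function.update c i l) ↔ crit Φ 𝒳 c i ≤ l := by
  refine ⟨crit_le, fun h => ?_⟩
  have := mem_chosen_update h𝒳 hΦ (mem_chosen_update_crit hi) (k := l) (by simpa using h) hl
  simpa using this

end Chosen

section Levels

variable {n t : ℕ}

lemma levCount_le (A : TLevel n t) (i : Fin n) (b : ℝ) : levCount A i b ≤ t := by
  simpa [levCount] using Finset.card_le_univ (Finset.univ.filter fun τ : Fin t => A.thr i τ ≤ b)

lemma lt_levCount_iff (A : TLevel n t) (i : Fin n) (b : ℝ) (k : Fin t) :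
    (k : ℕ) < levCount A i b ↔ A.thr i k ≤ b := by
  constructor
  · intro h
    by_contra hb
    have : (Finset.univ.filter fun τ : Fin t => A.thr i τ ≤ b) ⊆ Finset.Iio k := by
      intro τ hτ
      simp only [Finset.mem_filter, Finset.mem_univ, true_and, Finset.mem_Iio] at hτ ⊢
      by_contra hk
      exact hb ((A.mono i (not_lt.1 hk)).trans hτ)
    have := Finset.card_le_card this
    rw [Fin.card_Iio] at this
    exact absurd h (not_lt.2 this)
  · intro h
    have : Finset.Iic k ⊆ (Finset.univ.filter fun τ : Fin t => A.thr i τ ≤ b) := by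
      intro τ hτ
      simp only [Finset.mem_filter, Finset.mem_univ, true_and, Finset.mem_Iic] at hτ ⊢
      exact (A.mono i hτ).trans h
    have := Finset.card_le_card this
    rw [Fin.card_Iic] at this
    exact this

lemma le_levCount_iff (A : TLevel n t) (i : Fin n) (b : ℝ) {k : ℕ} (hk : k ≠ 0) (hkt : k ≤ t) :
    k ≤ levCount A i b ↔ phiAt (A.thr i) k ≤ b := by
  have h : k - 1 < t := by omega
  rw [phiAt, dif_pos h, ← lt_levCount_iff]
  simp only
  omega

lemma levCount_mono (A : TLevel n t) (i : Fin n) : Monotone (levCount A i) := by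
  intro b b' h
  refine Finset.card_le_card fun τ => ?_
  simp only [Finset.mem_filter, Finset.mem_univ, true_and]
  exact fun h' => h'.trans h

lemma levels_update (A : TLevel n t) (v : Fin n → ℝ) (i : Fin n) (b : ℝ) :
    levels A (Function.update v i b) = Function.update (levels A v) i (levCount A i b) := by
  ext j
  by_cases h : j = i
  · subst h; simp [levels]
  · simp [levels, h]

lemma measurable_levels (A : TLevel n t) : Measurable (levels A) :=
  measurable_pi_iff.2 fun i => (levCount_mono A i).measurable.comp (measurable_pi_apply i)

variable {Φ : Fin t → ℝ} {𝒳 : Finset (Finset (Fin n))}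

lemma mem_selected_update_iff (h𝒳 : ∅ ∈ 𝒳) (hΦ : Monotone Φ) (A : TLevel n t) {v : Fin n → ℝ}
    {i : Fin n} {b₀ : ℝ} (hi : i ∈ selected A Φ 𝒳 tieOrd (Function.update v i b₀)) (b : ℝ) :
    i ∈ selected A Φ 𝒳 tieOrd (Function.update v i b) ↔
      phiAt (A.thr i) (crit Φ 𝒳 (levels A v) i) ≤ b := by
  rw [selected_eq_chosen, levels_update] at hi ⊢
  rw [mem_chosen_update_iff h𝒳 hΦ hi (levCount_le A i b),
    le_levCount_iff A i b (crit_ne_zero hi) ((crit_le hi).trans (levCount_le A i b₀))]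

lemma payX_eq (h𝒳 : ∅ ∈ 𝒳) (hΦ : Monotone Φ) (A : TLevel n t) {v : Fin n → ℝ}
    {i : Fin n} (hi : i ∈ selected A Φ 𝒳 tieOrd v) :
    payX A Φ 𝒳 tieOrd v i = phiAt (A.thr i) (crit Φ 𝒳 (levels A v) i) := by
  have hi' : i ∈ selected A Φ 𝒳 tieOrd (Function.update v i (v i)) := by simpa using hi
  have : {b : ℝ | i ∈ selected A Φ 𝒳 tieOrd (Function.update v i b)} =
      Set.Ici (phiAt (A.thr i) (crit Φ 𝒳 (levels A v) i)) := by
    ext b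
    exact mem_selected_update_iff h𝒳 hΦ A hi' b
  rw [payX, this, csInf_Ici]

lemma payX_le (h𝒳 : ∅ ∈ 𝒳) (hΦ : Monotone Φ) (A : TLevel n t) {v : Fin n → ℝ}
    {i : Fin n} (hi : i ∈ selected A Φ 𝒳 tieOrd v) :
    payX A Φ 𝒳 tieOrd v i ≤ v i := by
  have hi' : i ∈ selected A Φ 𝒳 tieOrd (Function.update v i (v i)) := by simpa using hi
  rw [payX_eq h𝒳 hΦ A hi, ← mem_selected_update_iff h𝒳 hΦ A hi']
  exact hi'

lemma revX_eq (h𝒳 : ∅ ∈ 𝒳) (hΦ : Monotone Φ) (A : TLevel n t) (v : Fin n → ℝ) :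
    RevX A Φ 𝒳 tieOrd v = ∑ i ∈ chosen Φ 𝒳 (levels A v),
      phiAt (A.thr i) (crit Φ 𝒳 (levels A v) i) := by
  rw [RevX, ← selected_eq_chosen]
  exact Finset.sum_congr rfl fun _ hi => payX_eq h𝒳 hΦ A hi

lemma measurable_revX (h𝒳 : ∅ ∈ 𝒳) (hΦ : Monotone Φ) (A : TLevel n t) :
    Measurable (RevX A Φ 𝒳 tieOrd) := by
  have : RevX A Φ 𝒳 tieOrd = (fun c => ∑ i ∈ chosen Φ 𝒳 c, phiAt (A.thr i) (crit Φ 𝒳 c i)) ∘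
      levels A := funext fun v => revX_eq h𝒳 hΦ A v
  rw [this]
  exact (measurable_of_countable _).comp (measurable_levels A)

lemma sum_le_of_le {X : Finset (Fin n)} {a : Fin n → ℝ} {H : ℝ} (hH : 0 ≤ H)
    (ha : ∀ i ∈ X, a i ≤ H) : ∑ i ∈ X, a i ≤ n * H := by
  calc ∑ i ∈ X, a i ≤ ∑ _i ∈ X, H := Finset.sum_le_sum ha
    _ = X.card * H := by simp
    _ ≤ n * H := by
      gcongr
      simpa using Finset.card_le_univ X

lemma sum_le_of_mem_le {X : Finset (Fin n)} {a : Fin n → ℝ} {H : ℝ} (hH : 0 ≤ H)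
    (ha : ∀ i ∈ X, a i ≤ H) {j : Fin n} (hj : j ∈ X) : ∑ i ∈ X, a i ≤ a j + (n - 1) * H := by
  rw [← Finset.add_sum_erase _ _ hj]
  gcongr
  calc ∑ i ∈ X.erase j, a i ≤ ∑ _i ∈ X.erase j, H :=
        Finset.sum_le_sum fun i hi => ha i (Finset.mem_of_mem_erase hi)
    _ = (X.erase j).card * H := by simp
    _ ≤ (n - 1) * H := by
      gcongr
      rw [Finset.card_erase_of_mem hj]
      have : X.card ≤ n := by simpa using Finset.card_le_univ X
      have h1 : 1 ≤ X.card := Finset.card_pos.2 ⟨j, hj⟩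
      rw [Nat.cast_sub h1, Nat.cast_one]
      have : (X.card : ℝ) ≤ n := by exact_mod_cast this
      linarith

lemma revX_le (h𝒳 : ∅ ∈ 𝒳) (hΦ : Monotone Φ) (A : TLevel n t) {H : ℝ} (hH : 0 ≤ H)
    {v : Fin n → ℝ} (hv : ∀ i, v i ∈ Set.Icc 0 H) : RevX A Φ 𝒳 tieOrd v ≤ n * H :=
  sum_le_of_le hH fun i hi => (payX_le h𝒳 hΦ A hi).trans (hv i).2

end Levels

section Pricing

variable {S : ℝ → ℝ} {ℓ : ℕ → ℝ} {a s H : ℝ} {t : ℕ}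

/-- If `ℓ k` is an optimal price against the cost `a + s * k`, the revenue curve is dominated by
the accumulated tail probabilities. -/
lemma surplus_le_sum_tail (hS : Antitone S) (hS0 : ∀ x, 0 ≤ S x) (hs : 0 ≤ s)
    (hH : H ≤ a + s * t)
    (hmem : ∀ k, ℓ k ∈ Set.Icc 0 H)
    (hopt : ∀ k, k ≠ 0 → ∀ q ∈ Set.Icc 0 H,
      (q - (a + s * k)) * S q ≤ (ℓ k - (a + s * k)) * S (ℓ k))
    {p : ℝ} (hp : 0 ≤ p) (hℓp : ℓ 0 ≤ p) {k : ℕ} (hk : k ≤ t) {q : ℝ} (hq : q ∈ Set.Icc p H) :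
    (q - (a + s * k)) * S q ≤ s * ∑ σ ∈ Finset.Ico k t, S (max (ℓ σ) p) := by
  induction hk using Nat.decreasingInduction generalizing q with
  | self =>
    simp only [Finset.Ico_self, Finset.sum_empty, mul_zero]
    exact mul_nonpos_of_nonpos_of_nonneg (by linarith [hq.2]) (hS0 q)
  | of_succ k hk ih =>
    rw [Finset.sum_eq_sum_Ico_succ_bot hk, mul_add]
    push_cast at ih
    rcases le_total (ℓ k) p with h | h
    · rw [max_eq_right h]
      have h1 := ih hq
      have h2 : s * S q ≤ s * S p := mul_le_mul_of_nonneg_left (hS hq.1) hs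
      nlinarith
    · rw [max_eq_left h]
      have h1 := ih (q := ℓ k) ⟨h, (hmem k).2⟩
      rcases eq_or_ne k 0 with rfl | hk0
      · have hpe : ℓ 0 = p := le_antisymm hℓp h
        have h1 := ih hq
        have h2 : s * S q ≤ s * S (ℓ 0) := mul_le_mul_of_nonneg_left (hS (hpe ▸ hq.1)) hs
        push_cast at h1 ⊢
        nlinarith
      · have h3 := hopt k hk0 q ⟨hp.trans hq.1, hq.2⟩
        nlinarith

lemma sum_tail_le_surplus (hS0 : S H = 0) (hH : 0 ≤ H)
    (hmem : ∀ k, ℓ k ∈ Set.Icc 0 H)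
    (hopt : ∀ k, k ≠ 0 → ∀ q ∈ Set.Icc 0 H,
      (q - (a + s * k)) * S q ≤ (ℓ k - (a + s * k)) * S (ℓ k))
    {k : ℕ} (hk : k + 1 ≤ t) (hk0 : k ≠ 0) :
    s * ∑ σ ∈ Finset.Ico (k + 1) t, S (ℓ σ) ≤ (ℓ k - (a + s * k)) * S (ℓ k) := by
  obtain ⟨j, rfl⟩ := Nat.exists_eq_add_of_le hk
  clear hk
  induction j generalizing k with
  | zero =>
    have := hopt k hk0 H ⟨hH, le_rfl⟩
    rw [hS0] at this
    simpa using this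
  | succ j ih =>
    have h1 := ih (k := k + 1) (by omega)
    have e : k + 1 + (j + 1) = k + 1 + 1 + j := by ring
    rw [e, Finset.sum_eq_sum_Ico_succ_bot (by omega), mul_add]
    have h2 := hopt k hk0 (ℓ (k + 1)) (hmem _)
    push_cast at h1
    nlinarith

end Pricing

section Survival

variable {μ : Measure ℝ} [IsProbabilityMeasure μ] {H : ℝ}

lemma antitone_survival : Antitone fun p : ℝ => μ.real (Set.Ici p) :=
  fun _ _ h => measureReal_mono (Set.Ici_subset_Ici.2 h)

lemma continuous_cdf (hμ : ∀ x : ℝ, μ {x} = 0) : Continuous (ProbabilityTheory.cdf μ) := by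
  rw [continuous_iff_continuousAt]
  intro x
  have h := (ProbabilityTheory.cdf μ).measure_singleton x
  rw [ProbabilityTheory.measure_cdf, hμ, eq_comm, ENNReal.ofReal_eq_zero, sub_nonpos] at h
  rw [(ProbabilityTheory.monotone_cdf μ).continuousAt_iff_leftLim_eq_rightLim,
    StieltjesFunction.rightLim_eq]
  exact le_antisymm ((ProbabilityTheory.monotone_cdf μ).leftLim_le le_rfl) h

lemma survival_eq_one_sub_cdf (hμ : ∀ x : ℝ, μ {x} = 0) (p : ℝ) :
    μ.real (Set.Ici p) = 1 - ProbabilityTheory.cdf μ p := by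
  have : NullSingletonClass μ := ⟨hμ⟩
  rw [ProbabilityTheory.cdf_eq_real, ← probReal_compl_eq_one_sub measurableSet_Iic, Set.compl_Iic,
    measureReal_congr Ioi_ae_eq_Ici]

lemma continuous_survival (hμ : ∀ x : ℝ, μ {x} = 0) :
    Continuous fun p : ℝ => μ.real (Set.Ici p) := by
  simp_rw [survival_eq_one_sub_cdf hμ]
  exact continuous_const.sub (continuous_cdf hμ)

lemma survival_eq_zero (hμ : ∀ x : ℝ, μ {x} = 0) (hμH : μ (Set.Icc 0 H) = 1) :
    μ.real (Set.Ici H) = 0 := by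
  have : NullSingletonClass μ := ⟨hμ⟩
  have h : μ (Set.Icc 0 H)ᶜ = 0 := (prob_compl_eq_zero_iff measurableSet_Icc).2 hμH
  rw [measureReal_congr Ioi_ae_eq_Ici.symm, measureReal_eq_zero_iff]
  have hsub : Set.Ioi H ⊆ (Set.Icc 0 H)ᶜ := fun x hx hx' => absurd hx'.2 (not_le.2 hx)
  exact measure_mono_null hsub h

/-- Optimal posted prices in `[0, H]` against increasing production costs can be chosen
increasing. -/
lemma exists_monotone_optimal_price (hμ : ∀ x : ℝ, μ {x} = 0) (hH : 0 ≤ H) :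
    ∃ P : ℝ → ℝ, Monotone P ∧ (∀ c, P c ∈ Set.Icc 0 H) ∧ ∀ c, ∀ q ∈ Set.Icc 0 H,
      (q - c) * μ.real (Set.Ici q) ≤ (P c - c) * μ.real (Set.Ici (P c)) := by
  set S : ℝ → ℝ := fun p => μ.real (Set.Ici p) with hSdef
  have hS : Continuous S := continuous_survival hμ
  have hcont : ∀ c : ℝ, Continuous fun q => (q - c) * S q := fun c => by fun_prop
  have key : ∀ c : ℝ, ∃ p, IsGreatest {p | p ∈ Set.Icc 0 H ∧ ∀ q ∈ Set.Icc 0 H,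
      (q - c) * S q ≤ (p - c) * S p} p := by
    intro c
    apply IsCompact.exists_isGreatest
    · have : {p | p ∈ Set.Icc 0 H ∧ ∀ q ∈ Set.Icc 0 H, (q - c) * S q ≤ (p - c) * S p} =
          Set.Icc 0 H ∩ ⋂ q ∈ Set.Icc 0 H, {p | (q - c) * S q ≤ (p - c) * S p} := by
        ext p; simp
      rw [this]
      refine isCompact_Icc.inter_right (isClosed_biInter fun q _ => ?_)
      exact isClosed_le continuous_const (hcont c)
    · obtain ⟨p, hp, hmax⟩ := isCompact_Icc.exists_isMaxOn (Set.nonempty_Icc.2 hH)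
        (hcont c).continuousOn
      exact ⟨p, hp, fun q hq => hmax hq⟩
  choose P hP using key
  refine ⟨P, ?_, fun c => (hP c).1.1, fun c => (hP c).1.2⟩
  intro c c' hcc
  by_contra hlt
  rw [not_le] at hlt
  have h1 := (hP c).1.2 (P c') (hP c').1.1
  have h2 := (hP c').1.2 (P c) (hP c).1.1
  have h3 : S (P c) ≤ S (P c') := antitone_survival hlt.le
  have h4 : P c ∈ {p | p ∈ Set.Icc 0 H ∧ ∀ q ∈ Set.Icc 0 H, (q - c') * S q ≤ (p - c') * S p} := by
    refine ⟨(hP c).1.1, fun q hq => ((hP c').1.2 q hq).trans ?_⟩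
    nlinarith
  exact absurd ((hP c').2 h4) (not_le.2 hlt)

end Survival

section Virtual

variable {n t : ℕ} {Φ : Fin t → ℝ} {a s : ℝ}

lemma phiAt_eq (hΦ : ∀ τ, Φ τ = a + s * (τ : ℕ)) {c : ℕ} (hc : c ≠ 0) (hct : c ≤ t) :
    phiAt Φ c = a - s + s * c := by
  have h : c - 1 < t := by omega
  rw [phiAt, dif_pos h, hΦ]
  simp only
  rw [Nat.cast_sub (by omega)]
  push_cast
  ring

lemma levCount_eq_sum (A : TLevel n t) (i : Fin n) (x : ℝ) :
    (levCount A i x : ℝ) = ∑ τ, (Set.Ici (A.thr i τ)).indicator (fun _ => (1 : ℝ)) x := by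
  simp only [levCount, Finset.card_filter, Nat.cast_sum, Set.indicator_apply, Set.mem_Ici]
  simp

lemma setIntegral_phiAt (hΦ : ∀ τ, Φ τ = a + s * (τ : ℕ)) (A : TLevel n t) (i : Fin n)
    (μ : Measure ℝ) [IsProbabilityMeasure μ] {p : ℝ} (h0 : levCount A i p ≠ 0) :
    ∫ x in Set.Ici p, phiAt Φ (levCount A i x) ∂μ =
      (a - s) * μ.real (Set.Ici p) + s * ∑ τ, μ.real (Set.Ici (max (A.thr i τ) p)) := by
  have h1 : ∫ x in Set.Ici p, phiAt Φ (levCount A i x) ∂μ = ∫ x in Set.Ici p,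
      (a - s + s * ∑ τ, (Set.Ici (A.thr i τ)).indicator (fun _ => (1 : ℝ)) x) ∂μ := by
    refine setIntegral_congr_fun measurableSet_Ici fun x hx => ?_
    have := levCount_mono A i hx
    rw [phiAt_eq hΦ (by omega) (levCount_le A i x), levCount_eq_sum]
  have hint : ∀ τ, Integrable (fun x => (Set.Ici (A.thr i τ)).indicator (fun _ => (1 : ℝ)) x)
      (μ.restrict (Set.Ici p)) := fun τ =>
    (integrable_const _).indicator measurableSet_Ici
  rw [h1, integral_add (integrable_const _)
    ((integrable_finsetSum _ fun τ _ => hint τ).const_mul _), integral_const_mul,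
    integral_finsetSum _ fun τ _ => hint τ]
  simp only [integral_const, smul_eq_mul, measureReal_restrict_apply_univ]
  congr 1
  · ring
  · congr 1
    refine Finset.sum_congr rfl fun τ _ => ?_
    rw [integral_indicator measurableSet_Ici, Measure.restrict_restrict measurableSet_Ici,
      Set.Ici_inter_Ici]
    simp

end Virtual

section Resample

variable {n : ℕ} {Fi : Fin n → Measure ℝ} [∀ i, IsProbabilityMeasure (Fi i)]

lemma measurePreserving_update (i : Fin n) :
    MeasurePreserving (fun x : (Fin n → ℝ) × ℝ => Function.update x.1 i x.2)
      ((Measure.pi Fi).prod (Fi i)) (Measure.pi Fi) := by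
  have hmeas : Measurable fun x : (Fin n → ℝ) × ℝ => Function.update x.1 i x.2 :=
    measurable_update'.comp measurable_id
  refine ⟨hmeas, (Measure.pi_eq fun s hs => ?_).symm⟩
  rw [Measure.map_apply hmeas (MeasurableSet.univ_pi hs)]
  have : (fun x : (Fin n → ℝ) × ℝ => Function.update x.1 i x.2) ⁻¹' Set.univ.pi s =
      (Set.univ.pi (Function.update s i Set.univ)) ×ˢ s i := by
    ext ⟨v, b⟩
    simp only [Set.mem_preimage, Set.mem_pi, Set.mem_univ, true_imp_iff, Set.mem_prod]
    constructor
    · intro h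
      refine ⟨fun j => ?_, by simpa using h i⟩
      by_cases hj : j = i
      · subst hj; simp
      · simpa [hj] using h j
    · rintro ⟨h, hb⟩ j
      by_cases hj : j = i
      · subst hj; simpa using hb
      · simpa [hj] using h j
  rw [this, Measure.prod_prod, Measure.pi_pi]
  rw [← Finset.mul_prod_erase _ _ (Finset.mem_univ i),
    ← Finset.mul_prod_erase Finset.univ (fun j => Fi j (s j)) (Finset.mem_univ i)]
  simp only [Function.update_self, measure_univ, one_mul]
  rw [mul_comm]
  congr 1
  refine Finset.prod_congr rfl fun j hj => ?_
  rw [Function.update_of_ne (Finset.ne_of_mem_erase hj)]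

lemma integrable_update {f : (Fin n → ℝ) → ℝ} (hf : Integrable f (Measure.pi Fi)) (i : Fin n) :
    Integrable (fun x : (Fin n → ℝ) × ℝ => f (Function.update x.1 i x.2))
      ((Measure.pi Fi).prod (Fi i)) :=
  (measurePreserving_update i).integrable_comp_of_integrable hf

lemma integral_eq_integral_update {f : (Fin n → ℝ) → ℝ} (hf : Integrable f (Measure.pi Fi))
    (i : Fin n) :
    ∫ v, f v ∂Measure.pi Fi = ∫ v, ∫ b, f (Function.update v i b) ∂Fi i ∂Measure.pi Fi := by
  rw [← integral_prod _ (integrable_update hf i)]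
  conv_lhs => rw [← (measurePreserving_update (Fi := Fi) i).map_eq]
  refine integral_map (measurePreserving_update (Fi := Fi) i).measurable.aemeasurable ?_
  rw [(measurePreserving_update (Fi := Fi) i).map_eq]
  exact hf.aestronglyMeasurable

lemma integral_le_of_forall_update {f g : (Fin n → ℝ) → ℝ} (hf : Integrable f (Measure.pi Fi))
    (hg : Integrable g (Measure.pi Fi)) (i : Fin n) (s : ℝ)
    (h : ∀ᵐ v ∂Measure.pi Fi,
      ∫ b, f (Function.update v i b) ∂Fi i ≤ ∫ b, g (Function.update v i b) ∂Fi i + s) :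
    ∫ v, f v ∂Measure.pi Fi ≤ ∫ v, g v ∂Measure.pi Fi + s := by
  rw [integral_eq_integral_update hf i, integral_eq_integral_update hg i]
  have h1 := (integrable_update hg i).integral_prod_left
  calc _ ≤ ∫ v, (∫ b, g (Function.update v i b) ∂Fi i + s) ∂Measure.pi Fi :=
        integral_mono_ae (integrable_update hf i).integral_prod_left
          (h1.add (integrable_const s)) h
    _ = _ := by rw [integral_add h1 (integrable_const s)]; simp

lemma ae_pi_mem_Icc {H : ℝ} (h : ∀ i, Fi i (Set.Icc 0 H) = 1) :
    ∀ᵐ v ∂Measure.pi Fi, ∀ i, v i ∈ Set.Icc 0 H := by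
  rw [ae_all_iff]
  intro i
  have h1 : ∀ᵐ x ∂Fi i, x ∈ Set.Icc 0 H :=
    (prob_compl_eq_zero_iff measurableSet_Icc).2 (h i)
  exact (measurePreserving_eval Fi i).quasiMeasurePreserving.ae h1

end Resample

section SingleBidder

variable {μ : Measure ℝ} [IsProbabilityMeasure μ] {H : ℝ}

/-- A truthful mechanism facing a single bidder is a posted price, so its revenue is bounded by
the expected virtual value of the served types. -/
lemma integral_pay_le (hμ : ∀ x : ℝ, μ {x} = 0) (hμH : μ (Set.Icc 0 H) = 1)
    {φ : ℝ → ℝ} {s : ℝ} (hs : 0 ≤ s)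
    (hφ : ∀ p ∈ Set.Icc 0 H, p * μ.real (Set.Ici p) ≤ ∫ x in Set.Ici p, φ x ∂μ + s)
    {W : Set ℝ} {pay : ℝ → ℝ} (hpay0 : ∀ x, 0 ≤ pay x)
    (hpay : ∀ x ∈ Set.Icc 0 H, pay x ≤ x * (if x ∈ W then 1 else 0))
    (hdsic : ∀ x ∈ Set.Icc 0 H, ∀ b ∈ Set.Icc 0 H,
      x * (if b ∈ W then 1 else 0) - pay b ≤ x * (if x ∈ W then 1 else 0) - pay x) :
    ∫ x, pay x ∂μ ≤ ∫ x, W.indicator φ x ∂μ + s := by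
  have hV : ∀ᵐ x ∂μ, x ∈ Set.Icc 0 H := (prob_compl_eq_zero_iff measurableSet_Icc).2 hμH
  have hW0 : ∀ x ∈ Set.Icc 0 H, x ∉ W → pay x = 0 := fun x hx hxW => by
    have := hpay x hx
    rw [if_neg hxW, mul_zero] at this
    exact le_antisymm this (hpay0 x)
  by_cases hne : ∃ b ∈ Set.Icc 0 H, b ∈ W
  · obtain ⟨b₀, hb₀, hb₀W⟩ := hne
    set p := pay b₀ with hp
    have hpb : p ≤ b₀ := by simpa [hb₀W] using hpay b₀ hb₀
    have hpW : ∀ x ∈ Set.Icc 0 H, x ∈ W → pay x = p ∧ p ≤ x := by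
      intro x hx hxW
      have h1 := hdsic x hx b₀ hb₀
      have h2 := hdsic b₀ hb₀ x hx
      have h3 := hpay x hx
      simp only [hxW, hb₀W, if_true] at h1 h2 h3
      constructor <;> linarith
    have hmem : ∀ᵐ x ∂μ, x ∈ Set.Icc 0 H ∧ (x ∈ W ↔ x ∈ Set.Ici p) := by
      have hp' : ∀ᵐ x ∂μ, x ≠ p := by
        rw [ae_iff]; simpa using hμ p
      filter_upwards [hV, hp'] with x hx hxp
      refine ⟨hx, fun hxW => (hpW x hx hxW).2, fun hxp' => ?_⟩
      by_contra hxW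
      have h1 := hdsic x hx b₀ hb₀
      simp only [hxW, hb₀W, if_true, if_false, hW0 x hx hxW] at h1
      exact hxp (le_antisymm (by linarith) hxp')
    have e1 : pay =ᵐ[μ] (Set.Ici p).indicator fun _ => p := by
      filter_upwards [hmem] with x hx
      by_cases hxW : x ∈ W
      · rw [Set.indicator_of_mem (hx.2.1 hxW), (hpW x hx.1 hxW).1]
      · rw [Set.indicator_of_notMem (fun h => hxW (hx.2.2 h)), hW0 x hx.1 hxW]
    have e2 : W.indicator φ =ᵐ[μ] (Set.Ici p).indicator φ := by
      filter_upwards [hmem] with x hx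
      by_cases hxW : x ∈ W
      · rw [Set.indicator_of_mem hxW, Set.indicator_of_mem (hx.2.1 hxW)]
      · rw [Set.indicator_of_notMem hxW, Set.indicator_of_notMem fun h => hxW (hx.2.2 h)]
    rw [integral_congr_ae e1, integral_congr_ae e2, integral_indicator measurableSet_Ici,
      integral_indicator measurableSet_Ici]
    have := hφ p ⟨hpay0 _, hpb.trans hb₀.2⟩
    simpa [mul_comm] using this
  · push Not at hne
    have e1 : pay =ᵐ[μ] 0 := by
      filter_upwards [hV] with x hx using hW0 x hx (hne x hx)
    have e2 : W.indicator φ =ᵐ[μ] 0 := by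
      filter_upwards [hV] with x hx using Set.indicator_of_notMem (hne x hx) _
    rw [integral_congr_ae e1, integral_congr_ae e2]
    simpa using hs

end SingleBidder

/-- The estimates `a, a + s, a + 2 s, …`. -/
noncomputable def gridPhi (t : ℕ) (a s : ℝ) (τ : Fin t) : ℝ := a + s * (τ : ℕ)

lemma monotone_gridPhi {t : ℕ} {a s : ℝ} (hs : 0 ≤ s) : Monotone (gridPhi t a s) := by
  intro τ τ' h
  have : ((τ : ℕ) : ℝ) ≤ (τ' : ℕ) := by exact_mod_cast h
  unfold gridPhi
  gcongr

/-- The payment of bidder `i` in a `t`-level auction, as a function of the profile. -/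
noncomputable def levelPay {n t : ℕ} (A : TLevel n t) (Φ : Fin t → ℝ)
    (𝒳 : Finset (Finset (Fin n))) (i : Fin n) (v : Fin n → ℝ) : ℝ :=
  if i ∈ selected A Φ 𝒳 tieOrd v then payX A Φ 𝒳 tieOrd v i else 0

section LevelPay

variable {n t : ℕ} {Φ : Fin t → ℝ} {𝒳 : Finset (Finset (Fin n))}

lemma revX_eq_sum_levelPay (A : TLevel n t) (v : Fin n → ℝ) :
    RevX A Φ 𝒳 tieOrd v = ∑ i, levelPay A Φ 𝒳 i v := by
  simp [RevX, levelPay, Finset.sum_ite_mem]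

lemma measurable_levelPay (h𝒳 : ∅ ∈ 𝒳) (hΦ : Monotone Φ) (A : TLevel n t) (i : Fin n) :
    Measurable (levelPay A Φ 𝒳 i) := by
  have : levelPay A Φ 𝒳 i = (fun c => if i ∈ chosen Φ 𝒳 c then
      phiAt (A.thr i) (crit Φ 𝒳 c i) else 0) ∘ levels A := by
    funext v
    by_cases h : i ∈ selected A Φ 𝒳 tieOrd v
    · rw [levelPay, if_pos h, payX_eq h𝒳 hΦ A h, Function.comp, if_pos]
      rwa [← selected_eq_chosen]
    · rw [levelPay, if_neg h, Function.comp, if_neg]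
      rwa [← selected_eq_chosen]
  rw [this]
  exact (measurable_of_countable _).comp (measurable_levels A)

lemma phiAt_nonneg {f : Fin t → ℝ} (hf : ∀ τ, 0 ≤ f τ) (k : ℕ) : 0 ≤ phiAt f k := by
  rw [phiAt]
  split_ifs
  · exact hf _
  · exact le_rfl

lemma levelPay_mem_Icc (h𝒳 : ∅ ∈ 𝒳) (hΦ : Monotone Φ) (A : TLevel n t)
    (hA : ∀ i τ, 0 ≤ A.thr i τ) (i : Fin n) {H : ℝ} {v : Fin n → ℝ}
    (hv : ∀ i, v i ∈ Set.Icc 0 H) : levelPay A Φ 𝒳 i v ∈ Set.Icc 0 H := by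
  rw [levelPay]
  split_ifs with h
  · refine ⟨?_, (payX_le h𝒳 hΦ A h).trans (hv i).2⟩
    rw [payX_eq h𝒳 hΦ A h]
    exact phiAt_nonneg (hA i) _
  · exact ⟨le_rfl, (hv i).1.trans (hv i).2⟩

lemma one_lt_of_mem_chosen_update {H : ℝ} (hH : 0 < H) (h𝒳 : ∅ ∈ 𝒳) {s : ℝ}
    (hΦH : ∀ τ, gridPhi t (-(n * H)) s τ ≤ H) {c : Fin n → ℕ} (hct : ∀ i, c i ≤ t)
    {i : Fin n} {k : ℕ} (hkt : k ≤ t)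
    (hi : i ∈ chosen (gridPhi t (-(n * H)) s) 𝒳 (Function.update c i k)) : 1 < k := by
  have hc := ne_zero_of_mem_chosen hi
  have hk0 : k ≠ 0 := by simpa using hc i
  by_contra hk
  obtain rfl : k = 1 := by omega
  have h1 := sum_le_sum_chosen (Φ := gridPhi t (-(n * H)) s) h𝒳 hc h𝒳
  have h2 : ∀ j ∈ chosen (gridPhi t (-(n * H)) s) 𝒳 (Function.update c i 1),
      phiAt (gridPhi t (-(n * H)) s) (Function.update c i 1 j) ≤ H := by
    intro j _
    have hj : Function.update c i 1 j ≤ t := by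
      by_cases hj : j = i
      · subst hj; simpa using hkt
      · simpa [hj] using hct j
    have h0 := hc j
    rw [phiAt, dif_pos (by omega)]
    exact hΦH _
  have h3 := sum_le_of_mem_le hH.le h2 hi
  rw [Finset.sum_empty] at h1
  have h4 : phiAt (gridPhi t (-(n * H)) s) (Function.update c i 1 i) = -(n * H) := by
    rw [phiAt_eq (Φ := gridPhi t (-(n * H)) s) (fun τ => rfl) (hc i) (by simpa using hkt)]
    simp
  rw [h4] at h3
  nlinarith

end LevelPay

/-- The estimate attached to bidder `i` bidding `x`. -/
noncomputable def virt {n t : ℕ} (A : TLevel n t) (Φ : Fin t → ℝ) (i : Fin n) (x : ℝ) : ℝ :=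
  phiAt Φ (levCount A i x)

section Virt

variable {n t : ℕ} {Φ : Fin t → ℝ} {𝒳 : Finset (Finset (Fin n))}

lemma measurable_virt (A : TLevel n t) (i : Fin n) : Measurable (virt A Φ i) :=
  (measurable_of_countable (phiAt Φ)).comp (levCount_mono A i).measurable

lemma exists_abs_phiAt_le (Φ : Fin t → ℝ) : ∃ C, ∀ k, |phiAt Φ k| ≤ C := by
  refine ⟨∑ τ, |Φ τ|, fun k => ?_⟩
  rw [phiAt]
  split_ifs with h
  · exact Finset.single_le_sum (f := fun τ => |Φ τ|) (fun _ _ => abs_nonneg _)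
      (Finset.mem_univ _)
  · simpa using Finset.sum_nonneg fun τ _ => abs_nonneg (Φ τ)

lemma measurable_chosen_mem (A : TLevel n t) (i : Fin n) :
    MeasurableSet {v | i ∈ selected A Φ 𝒳 tieOrd v} := by
  have : {v | i ∈ selected A Φ 𝒳 tieOrd v} = levels A ⁻¹' {c | i ∈ chosen Φ 𝒳 c} := by
    ext v
    rw [Set.mem_ofPred_eq, selected_eq_chosen]
    rfl
  rw [this]
  exact measurable_levels A (Set.to_countable _).measurableSet

lemma integrable_indicator_virt (μ : Measure (Fin n → ℝ)) [IsFiniteMeasure μ] (A : TLevel n t)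
    (i : Fin n) {W : Set (Fin n → ℝ)} (hW : MeasurableSet W) :
    Integrable (W.indicator fun v => virt A Φ i (v i)) μ := by
  obtain ⟨C, hC⟩ := exists_abs_phiAt_le Φ
  refine Integrable.indicator ?_ hW
  exact Integrable.of_bound ((measurable_virt A i).comp (measurable_pi_apply i)).aestronglyMeasurable
    C (Filter.Eventually.of_forall fun v => hC _)

lemma sum_indicator_virt (A : TLevel n t) (f : (Fin n → ℝ) → Finset (Fin n)) (v : Fin n → ℝ) :
    ∑ i, {v | i ∈ f v}.indicator (fun v => virt A Φ i (v i)) v =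
      ∑ i ∈ f v, phiAt Φ (levCount A i (v i)) := by
  simp [Set.indicator_apply, virt, Finset.sum_ite_mem]

end Virt

/-- The thresholds of `A` are `0` followed by optimal posted prices in `[0, H]` against the
production costs `a + s`, `a + 2 s`, …. -/
structure IsOptimalPricing {n t : ℕ} (A : TLevel n t) (Fi : Fin n → Measure ℝ)
    (a s H : ℝ) (ℓ : Fin n → ℕ → ℝ) : Prop where
  thr_eq : ∀ i (τ : Fin t), A.thr i τ = ℓ i τ
  zero : ∀ i, ℓ i 0 = 0
  mem : ∀ i k, ℓ i k ∈ Set.Icc 0 H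
  opt : ∀ i k, k ≠ 0 → ∀ q ∈ Set.Icc 0 H,
    (q - (a + s * k)) * (Fi i).real (Set.Ici q) ≤
      (ℓ i k - (a + s * k)) * (Fi i).real (Set.Ici (ℓ i k))

lemma exists_isOptimalPricing {n : ℕ} (t : ℕ) {Fi : Fin n → Measure ℝ}
    [∀ i, IsProbabilityMeasure (Fi i)] (hF : ∀ i, ∀ x : ℝ, Fi i {x} = 0)
    (a : ℝ) {s H : ℝ} (hH : 0 ≤ H) (hs : 0 ≤ s) :
    ∃ (A : TLevel n t) (ℓ : Fin n → ℕ → ℝ), IsOptimalPricing A Fi a s H ℓ := by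
  choose P hP using fun i => exists_monotone_optimal_price (hF i) hH
  let ℓ : Fin n → ℕ → ℝ := fun i k => if k = 0 then 0 else P i (a + s * k)
  have hmem : ∀ i k, ℓ i k ∈ Set.Icc 0 H := by
    intro i k
    by_cases h : k = 0
    · simp [ℓ, h, hH]
    · simpa [ℓ, h] using (hP i).2.1 (a + s * k)
  have hmono : ∀ i, Monotone (ℓ i) := by
    intro i k l hkl
    by_cases h : k = 0
    · have : ℓ i k = 0 := by simp [ℓ, h]
      rw [this]
      exact (hmem i l).1
    · have hl : l ≠ 0 := by omega
      simp only [ℓ, h, hl, if_false]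
      apply (hP i).1
      gcongr
  refine ⟨⟨fun i τ => ℓ i τ, fun i τ τ' h => hmono i h⟩, ℓ, fun _ _ => rfl, ?_, hmem, ?_⟩
  · intro i; simp [ℓ]
  · intro i k hk q hq
    simp only [ℓ, hk, if_false]
    exact (hP i).2.2 _ q hq

namespace IsOptimalPricing

variable {n t : ℕ} {A : TLevel n t} {Fi : Fin n → Measure ℝ} {a s H : ℝ} {ℓ : Fin n → ℕ → ℝ}

lemma thr_nonneg (h : IsOptimalPricing A Fi a s H ℓ) (i : Fin n) (τ : Fin t) :
    0 ≤ A.thr i τ := by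
  rw [h.thr_eq]
  exact (h.mem i _).1

lemma levCount_ne_zero (h : IsOptimalPricing A Fi a s H ℓ) (ht : 0 < t) (i : Fin n) {x : ℝ}
    (hx : 0 ≤ x) : levCount A i x ≠ 0 := by
  have := (lt_levCount_iff A i x ⟨0, ht⟩).2 (by rw [h.thr_eq]; simpa [h.zero] using hx)
  simp only at this
  omega

variable [∀ i, IsProbabilityMeasure (Fi i)]

lemma revenue_le (h : IsOptimalPricing A Fi a s H ℓ) (ht : 0 < t) (hs : 0 ≤ s)
    (hH : H ≤ a + s * t) (i : Fin n) {p : ℝ} (hp : p ∈ Set.Icc 0 H) :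
    p * (Fi i).real (Set.Ici p) ≤
      ∫ x in Set.Ici p, virt A (gridPhi t a s) i x ∂Fi i + s := by
  simp only [virt]
  rw [setIntegral_phiAt (Φ := gridPhi t a s) (a := a) (s := s) (fun _ => rfl) A i (Fi i) (h.levCount_ne_zero ht i hp.1)]
  have h1 := surplus_le_sum_tail (t := t) (S := fun p => (Fi i).real (Set.Ici p))
    antitone_survival (fun _ => measureReal_nonneg) hs hH (h.mem i) (h.opt i) hp.1
    (by rw [h.zero]; exact hp.1) (Nat.zero_le t) (q := p) ⟨le_rfl, hp.2⟩
  have h2 : ∑ τ : Fin t, (Fi i).real (Set.Ici (max (A.thr i τ) p)) =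
      ∑ σ ∈ Finset.Ico 0 t, (Fi i).real (Set.Ici (max (ℓ i σ) p)) := by
    simp_rw [h.thr_eq]
    rw [Finset.sum_fin_eq_sum_range, Finset.range_eq_Ico]
    refine Finset.sum_congr rfl fun σ hσ => ?_
    rw [dif_pos (Finset.mem_Ico.1 hσ).2]
  rw [h2]
  simp only [Nat.cast_zero, mul_zero, add_zero] at h1
  have h3 : (Fi i).real (Set.Ici p) ≤ 1 := measureReal_le_one
  nlinarith

lemma le_revenue (h : IsOptimalPricing A Fi a s H ℓ) (i : Fin n)
    (hF : ∀ x : ℝ, Fi i {x} = 0) (hFH : Fi i (Set.Icc 0 H) = 1) (hH : 0 ≤ H) {k : ℕ} (hk : 1 < k) (hkt : k ≤ t) :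
    ∫ x in Set.Ici (phiAt (A.thr i) k), virt A (gridPhi t a s) i x ∂Fi i ≤
      phiAt (A.thr i) k * (Fi i).real (Set.Ici (phiAt (A.thr i) k)) := by
  have hp : phiAt (A.thr i) k = ℓ i (k - 1) := by
    rw [phiAt, dif_pos (by omega), h.thr_eq]
  have hlev := (le_levCount_iff A i (phiAt (A.thr i) k) (by omega) hkt).2 le_rfl
  simp only [virt]
  rw [setIntegral_phiAt (Φ := gridPhi t a s) (a := a) (s := s) (fun _ => rfl) A i (Fi i) (by omega)]
  have h1 := sum_tail_le_surplus (t := t) (S := fun p => (Fi i).real (Set.Ici p))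
    (survival_eq_zero hF hFH) hH (h.mem i) (h.opt i) (k := k - 1) (by omega) (by omega)
  have e : k - 1 + 1 = k := by omega
  rw [e] at h1
  have hmono : ∀ σ τ : ℕ, σ ≤ τ → τ < t → ℓ i σ ≤ ℓ i τ := by
    intro σ τ hστ hτ
    have := A.mono i (show (⟨σ, by omega⟩ : Fin t) ≤ ⟨τ, hτ⟩ from hστ)
    simpa only [h.thr_eq] using this
  have h2 : ∑ τ : Fin t, (Fi i).real (Set.Ici (max (A.thr i τ) (phiAt (A.thr i) k))) =
      k * (Fi i).real (Set.Ici (ℓ i (k - 1))) +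
        ∑ σ ∈ Finset.Ico k t, (Fi i).real (Set.Ici (ℓ i σ)) := by
    simp_rw [hp, h.thr_eq]
    rw [Finset.sum_fin_eq_sum_range, Finset.range_eq_Ico,
      ← Finset.sum_Ico_consecutive _ (Nat.zero_le k) hkt]
    congr 1
    · rw [Finset.sum_congr rfl (g := fun _ => (Fi i).real (Set.Ici (ℓ i (k - 1))))]
      · simp
      · intro σ hσ
        have := (Finset.mem_Ico.1 hσ).2
        rw [dif_pos (by omega), max_eq_right (hmono σ (k - 1) (by omega) (by omega))]
    · refine Finset.sum_congr rfl fun σ hσ => ?_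
      have := Finset.mem_Ico.1 hσ
      rw [dif_pos this.2, max_eq_left (hmono _ _ (by omega) this.2)]
  rw [h2, hp]
  have e2 : ((k - 1 : ℕ) : ℝ) = k - 1 := by rw [Nat.cast_sub (by omega)]; simp
  rw [e2] at h1
  nlinarith

variable {𝒳 : Finset (Finset (Fin n))}

/-- Fixing the other bids, a `t`-level auction with optimal prices earns from bidder `i` at least
her expected estimate when she is selected. -/
lemma integral_virt_le_integral_levelPay (h : IsOptimalPricing A Fi (-(n * H)) s H ℓ)
    (h𝒳 : ∅ ∈ 𝒳) (hH : 0 < H) (hs : 0 ≤ s) (hΦH : ∀ τ, gridPhi t (-(n * H)) s τ ≤ H)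
    (i : Fin n) (hF : ∀ x : ℝ, Fi i {x} = 0) (hFH : Fi i (Set.Icc 0 H) = 1) (v : Fin n → ℝ) :
    ∫ b, {v | i ∈ selected A (gridPhi t (-(n * H)) s) 𝒳 tieOrd v}.indicator
        (fun v => virt A (gridPhi t (-(n * H)) s) i (v i)) (Function.update v i b) ∂Fi i ≤
      ∫ b, levelPay A (gridPhi t (-(n * H)) s) 𝒳 i (Function.update v i b) ∂Fi i := by
  set Φ := gridPhi t (-(n * H)) s with hΦdef
  have hΦ : Monotone Φ := monotone_gridPhi hs
  by_cases hne : ∃ b₀, i ∈ selected A Φ 𝒳 tieOrd (Function.update v i b₀)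
  · obtain ⟨b₀, hb₀⟩ := hne
    have hiff := mem_selected_update_iff h𝒳 hΦ A hb₀
    have hb₀' := hb₀
    rw [selected_eq_chosen, levels_update] at hb₀'
    set k := crit Φ 𝒳 (levels A v) i with hk
    have hkt : k ≤ t := (crit_le hb₀').trans (levCount_le A i b₀)
    have hk1 : 1 < k := one_lt_of_mem_chosen_update hH h𝒳 hΦH
      (fun j => levCount_le A j (v j)) hkt (mem_chosen_update_crit hb₀')
    have e1 : (fun b => {v | i ∈ selected A Φ 𝒳 tieOrd v}.indicator
        (fun v => virt A Φ i (v i)) (Function.update v i b)) =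
        (Set.Ici (phiAt (A.thr i) k)).indicator (virt A Φ i) := by
      funext b
      by_cases hb : i ∈ selected A Φ 𝒳 tieOrd (Function.update v i b)
      · rw [Set.indicator_of_mem (s := {v | i ∈ selected A Φ 𝒳 tieOrd v}) hb,
          Set.indicator_of_mem (Set.mem_Ici.2 ((hiff b).1 hb)), Function.update_self]
      · rw [Set.indicator_of_notMem (s := {v | i ∈ selected A Φ 𝒳 tieOrd v}) hb,
          Set.indicator_of_notMem (s := Set.Ici (phiAt (A.thr i) k))
            (fun h' => hb ((hiff b).2 h'))]
    have e2 : (fun b => levelPay A Φ 𝒳 i (Function.update v i b)) =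
        (Set.Ici (phiAt (A.thr i) k)).indicator fun _ => phiAt (A.thr i) k := by
      funext b
      by_cases hb : i ∈ selected A Φ 𝒳 tieOrd (Function.update v i b)
      · rw [levelPay, if_pos hb, Set.indicator_of_mem (Set.mem_Ici.2 ((hiff b).1 hb)),
          payX_eq h𝒳 hΦ A hb]
        congr 1
        simp [crit, levels_update, hk]
      · rw [levelPay, if_neg hb, Set.indicator_of_notMem (s := Set.Ici (phiAt (A.thr i) k))
          (fun h' => hb ((hiff b).2 h'))]
    rw [e1, e2, integral_indicator measurableSet_Ici, integral_indicator measurableSet_Ici]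
    rw [setIntegral_const, smul_eq_mul, mul_comm]
    exact h.le_revenue i hF hFH hH.le hk1 hkt
  · push Not at hne
    have e1 : (fun b => {v | i ∈ selected A Φ 𝒳 tieOrd v}.indicator
        (fun v => virt A Φ i (v i)) (Function.update v i b)) = fun _ => 0 := by
      funext b
      exact Set.indicator_of_notMem (s := {v | i ∈ selected A Φ 𝒳 tieOrd v}) (hne b) _
    have e2 : (fun b => levelPay A Φ 𝒳 i (Function.update v i b)) = fun _ => 0 := by
      funext b
      rw [levelPay, if_neg (hne b)]
    rw [e1, e2]

lemma integrable_levelPay (h : IsOptimalPricing A Fi a s H ℓ) (h𝒳 : ∅ ∈ 𝒳)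
    {Φ : Fin t → ℝ} (hΦ : Monotone Φ) (hFH : ∀ i, Fi i (Set.Icc 0 H) = 1) (i : Fin n) :
    Integrable (levelPay A Φ 𝒳 i) (Measure.pi Fi) := by
  refine Integrable.of_mem_Icc 0 H (measurable_levelPay h𝒳 hΦ A i).aemeasurable ?_
  filter_upwards [ae_pi_mem_Icc hFH] with v hv using levelPay_mem_Icc h𝒳 hΦ A h.thr_nonneg i hv

/-- Optimal prices make a `t`-level auction optimal up to `n * s`. -/
theorem optX_le (h : IsOptimalPricing A Fi (-(n * H)) s H ℓ)
    (h𝒳 : ∅ ∈ 𝒳) (hH : 0 < H) (hs : 0 ≤ s) (ht : 0 < t)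
    (hΦH : ∀ τ, gridPhi t (-(n * H)) s τ ≤ H) (htH : H ≤ -(n * H) + s * t)
    (hF : ∀ i, ∀ x : ℝ, Fi i {x} = 0) (hFH : ∀ i, Fi i (Set.Icc 0 H) = 1) :
    OPTX n 𝒳 (Set.Icc 0 H) (Measure.pi Fi) ≤ ENNReal.ofReal
      (∫ v, RevX A (gridPhi t (-(n * H)) s) 𝒳 tieOrd v ∂Measure.pi Fi + n * s) := by
  refine iSup_le fun B => ?_
  set Φ := gridPhi t (-(n * H)) s with hΦdef
  have hΦ : Monotone Φ := monotone_gridPhi hs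
  have hsupp := ae_pi_mem_Icc hFH
  have hWB : ∀ i, MeasurableSet {v | i ∈ B.choice v} := by
    intro i
    have : {v | i ∈ B.choice v} = ⋃ X ∈ {X : Finset (Fin n) | i ∈ X}, {v | B.choice v = X} := by
      ext v; simp
    rw [this]
    exact MeasurableSet.biUnion (Set.to_countable _) fun X _ => B.choice_meas X
  have hpayint : ∀ i, Integrable (fun v => B.pay v i) (Measure.pi Fi) := by
    intro i
    refine Integrable.of_mem_Icc 0 H (B.pay_meas i).aemeasurable ?_
    filter_upwards [hsupp] with v hv
    refine ⟨B.pay_nonneg v i, (B.pay_le v hv i).trans ?_⟩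
    split_ifs
    · simpa using (hv i).2
    · simpa using hH.le
  have hupper : ∀ i, ∫ v, B.pay v i ∂Measure.pi Fi ≤
      ∫ v, {v | i ∈ B.choice v}.indicator (fun v => virt A Φ i (v i)) v ∂Measure.pi Fi + s := by
    intro i
    refine integral_le_of_forall_update (hpayint i)
      (integrable_indicator_virt _ A i (hWB i)) i s ?_
    filter_upwards [hsupp] with v hv
    have hv' : ∀ b ∈ Set.Icc 0 H, ∀ j, Function.update v i b j ∈ Set.Icc 0 H := by
      intro b hb j
      by_cases hj : j = i
      · subst hj; simpa using hb
      · simpa [hj] using hv j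
    have := integral_pay_le (hF i) (hFH i) hs (fun p hp => h.revenue_le ht hs htH i hp)
      (W := {b | i ∈ B.choice (Function.update v i b)})
      (pay := fun b => B.pay (Function.update v i b) i)
      (fun b => B.pay_nonneg _ i)
      (fun b hb => by simpa using B.pay_le _ (hv' b hb) i)
      (fun x hx b hb => by simpa using B.dsic _ (hv' x hx) i b hb)
    refine this.trans_eq ?_
    congr 2
    funext b
    simp [Set.indicator_apply, Φ]
  have hlower : ∀ i, ∫ v, {v | i ∈ selected A Φ 𝒳 tieOrd v}.indicator
      (fun v => virt A Φ i (v i)) v ∂Measure.pi Fi ≤ ∫ v, levelPay A Φ 𝒳 i v ∂Measure.pi Fi := by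
    intro i
    have := integral_le_of_forall_update
      (integrable_indicator_virt (Φ := Φ) (Measure.pi Fi) A i
        (measurable_chosen_mem (Φ := Φ) (𝒳 := 𝒳) A i))
      (h.integrable_levelPay h𝒳 hΦ hFH i) i 0 (Filter.Eventually.of_forall fun v => by
        rw [add_zero]
        exact h.integral_virt_le_integral_levelPay h𝒳 hH hs hΦH i (hF i) (hFH i) v)
    simpa using this
  have hmid : ∫ v, ∑ i, {v | i ∈ B.choice v}.indicator (fun v => virt A Φ i (v i)) v
        ∂Measure.pi Fi ≤
      ∫ v, ∑ i, {v | i ∈ selected A Φ 𝒳 tieOrd v}.indicator (fun v => virt A Φ i (v i)) v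
        ∂Measure.pi Fi := by
    refine integral_mono_ae
      (integrable_finsetSum _ fun i _ => integrable_indicator_virt _ A i (hWB i))
      (integrable_finsetSum _ fun i _ => integrable_indicator_virt _ A i
        (measurable_chosen_mem (Φ := Φ) (𝒳 := 𝒳) A i)) ?_
    filter_upwards [hsupp] with v hv
    rw [sum_indicator_virt A B.choice, sum_indicator_virt A (selected A Φ 𝒳 tieOrd),
      selected_eq_chosen]
    exact sum_le_sum_chosen (c := levels A v) h𝒳
      (fun i => h.levCount_ne_zero ht i (hv i).1) (B.choice_mem v)
  rw [integral_finsetSum _ fun i _ => integrable_indicator_virt _ A i (hWB i),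
    integral_finsetSum _ fun i _ => integrable_indicator_virt _ A i
        (measurable_chosen_mem (Φ := Φ) (𝒳 := 𝒳) A i)] at hmid
  have hrev : ∫ v, RevX A Φ 𝒳 tieOrd v ∂Measure.pi Fi =
      ∑ i, ∫ v, levelPay A Φ 𝒳 i v ∂Measure.pi Fi := by
    simp_rw [revX_eq_sum_levelPay]
    exact integral_finsetSum _ fun i _ => h.integrable_levelPay h𝒳 hΦ hFH i
  have hB : ∫⁻ v, ∑ i, ENNReal.ofReal (B.pay v i) ∂Measure.pi Fi =
      ENNReal.ofReal (∑ i, ∫ v, B.pay v i ∂Measure.pi Fi) := by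
    rw [← integral_finsetSum _ fun i _ => hpayint i, ofReal_integral_eq_lintegral_ofReal
      (integrable_finsetSum _ fun i _ => hpayint i)
      (Filter.Eventually.of_forall fun v => Finset.sum_nonneg fun i _ => B.pay_nonneg v i)]
    congr 1
    funext v
    rw [ENNReal.ofReal_sum_of_nonneg fun i _ => B.pay_nonneg v i]
  rw [hB]
  apply ENNReal.ofReal_le_ofReal
  rw [hrev]
  have h1 := Finset.sum_le_sum fun i (_ : i ∈ Finset.univ) => hupper i
  have h2 := Finset.sum_le_sum fun i (_ : i ∈ Finset.univ) => hlower i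
  rw [Finset.sum_add_distrib] at h1
  simp only [Finset.sum_const, Finset.card_univ, Fintype.card_fin, nsmul_eq_mul] at h1
  linarith

end IsOptimalPricing

/-- The optimal revenue is at most `n * H`. -/
lemma optX_le_mul {n : ℕ} {𝒳 : Finset (Finset (Fin n))} {Fi : Fin n → Measure ℝ}
    [∀ i, IsProbabilityMeasure (Fi i)] {H : ℝ} (hH : 0 ≤ H)
    (hFH : ∀ i, Fi i (Set.Icc 0 H) = 1) :
    OPTX n 𝒳 (Set.Icc 0 H) (Measure.pi Fi) ≤ ENNReal.ofReal (n * H) := by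
  refine iSup_le fun B => ?_
  calc ∫⁻ v, ∑ i, ENNReal.ofReal (B.pay v i) ∂Measure.pi Fi
      ≤ ∫⁻ _v, ENNReal.ofReal (n * H) ∂Measure.pi Fi := by
        refine lintegral_mono_ae ?_
        filter_upwards [ae_pi_mem_Icc hFH] with v hv
        rw [← ENNReal.ofReal_sum_of_nonneg fun i _ => B.pay_nonneg v i]
        refine ENNReal.ofReal_le_ofReal (sum_le_of_le hH fun i _ => (B.pay_le v hv i).trans ?_)
        split_ifs
        · simpa using (hv i).2
        · simpa using hH
    _ = _ := by simp

/-- A monotone quantization of the line whose cells have small measure and small diameter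
inside `[a, b]`. -/
lemma exists_quantizer (μ : Measure ℝ) [IsProbabilityMeasure μ] (hμ : ∀ x : ℝ, μ {x} = 0)
    {N w a b : ℝ} (hN : 0 < N) (hw : 0 < w) (hab : a ≤ b) :
    ∃ κ : ℝ → ℕ, Monotone κ ∧ (∀ x, (κ x : ℝ) ≤ N + (b - a) / w) ∧
      (∀ x y, κ x = κ y → |max a (min x b) - max a (min y b)| ≤ w) ∧
      ∀ k, μ (κ ⁻¹' {k}) ≤ ENNReal.ofReal (1 / N) := by
  have hq : Monotone fun x : ℝ => (max a (min x b) - a) / w := by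
    intro x y hxy
    dsimp only
    gcongr
  have hq0 : ∀ x : ℝ, 0 ≤ (max a (min x b) - a) / w := fun x =>
    div_nonneg (sub_nonneg.2 (le_max_left _ _)) hw.le
  have hc : Monotone fun x : ℝ => N * ProbabilityTheory.cdf μ x := fun x y hxy =>
    mul_le_mul_of_nonneg_left (ProbabilityTheory.monotone_cdf μ hxy) hN.le
  have hc0 : ∀ x : ℝ, 0 ≤ N * ProbabilityTheory.cdf μ x := fun x =>
    mul_nonneg hN.le (ProbabilityTheory.cdf_nonneg μ x)
  have key : ∀ x y, x ≤ y →
      ⌊N * ProbabilityTheory.cdf μ x + (max a (min x b) - a) / w⌋₊ =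
        ⌊N * ProbabilityTheory.cdf μ y + (max a (min y b) - a) / w⌋₊ →
      ProbabilityTheory.cdf μ y - ProbabilityTheory.cdf μ x ≤ 1 / N ∧
        max a (min y b) - max a (min x b) ≤ w := by
    intro x y hxy h
    have h1 := Nat.floor_le (add_nonneg (hc0 x) (hq0 x))
    have h2 := Nat.lt_floor_add_one (N * ProbabilityTheory.cdf μ y + (max a (min y b) - a) / w)
    rw [← h] at h2
    have h3 := hq hxy
    have h4 := hc hxy
    dsimp only at h3 h4
    have h5 : (max a (min y b) - max a (min x b)) / w =
        (max a (min y b) - a) / w - (max a (min x b) - a) / w := by ring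
    constructor
    · rw [le_div_iff₀ hN]
      linarith
    · have : (max a (min y b) - max a (min x b)) / w ≤ 1 := by linarith
      rwa [div_le_one hw] at this
  refine ⟨fun x => ⌊N * ProbabilityTheory.cdf μ x + (max a (min x b) - a) / w⌋₊,
    fun x y hxy => Nat.floor_mono (add_le_add (hc hxy) (hq hxy)), fun x => ?_, fun x y h => ?_,
    fun k => ?_⟩
  · refine (Nat.floor_le (add_nonneg (hc0 x) (hq0 x))).trans ?_
    have h1 := ProbabilityTheory.cdf_le_one μ x
    have h2 : max a (min x b) ≤ b := max_le hab (min_le_right _ _)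
    gcongr
    nlinarith
  · rcases le_total x y with hxy | hxy
    · rw [abs_sub_comm, abs_of_nonneg (sub_nonneg.2 (by gcongr))]
      exact (key x y hxy h).2
    · rw [abs_of_nonneg (sub_nonneg.2 (by gcongr))]
      exact (key y x hxy h.symm).2
  · have hmono : Monotone fun x =>
        ⌊N * ProbabilityTheory.cdf μ x + (max a (min x b) - a) / w⌋₊ :=
      fun x y hxy => Nat.floor_mono (add_le_add (hc hxy) (hq hxy))
    rw [(hmono.measurable (measurableSet_singleton k)).measure_eq_iSup_isCompact]
    refine iSup₂_le fun K hK => iSup_le fun hKc => ?_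
    rcases K.eq_empty_or_nonempty with rfl | hne
    · simp
    obtain ⟨x, hx⟩ := hKc.exists_isLeast hne
    obtain ⟨y, hy⟩ := hKc.exists_isGreatest hne
    have hsub : K ⊆ {x} ∪ Set.Ioc x y := fun z hz => by
      rcases (hx.2 hz).eq_or_lt with h | h
      · exact Or.inl h.symm
      · exact Or.inr ⟨h, hy.2 hz⟩
    calc μ K ≤ μ {x} + μ (Set.Ioc x y) := (measure_mono hsub).trans (measure_union_le _ _)
      _ = (ProbabilityTheory.cdf μ).measure (Set.Ioc x y) := by
        rw [hμ, zero_add, ProbabilityTheory.measure_cdf]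
      _ ≤ _ := by
        rw [StieltjesFunction.measure_Ioc]
        exact ENNReal.ofReal_le_ofReal
          (key x y (hx.2 hy.1) ((hK hx.1).trans (hK hy.1).symm)).1

/-- One-sided Hoeffding inequality for the sum of a bounded function over a sample. -/
lemma measure_pi_sum_ge_le {α : Type*} [MeasurableSpace α] (μ : Measure α)
    [IsProbabilityMeasure μ] {g : α → ℝ} (hg : Measurable g) {B r : ℝ} (hB : 0 < B) (hr : 0 ≤ r)
    (hgB : ∀ x, g x ∈ Set.Icc 0 B) (m : ℕ) :
    (Measure.pi fun _ : Fin m => μ) {S | m * (∫ x, g x ∂μ + r) ≤ ∑ j, g (S j)} ≤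
      ENNReal.ofReal (Real.exp (-(2 * m * r ^ 2 / B ^ 2))) := by
  set P := Measure.pi fun _ : Fin m => μ
  let Y : α → ℝ := fun x => g x - ∫ x, g x ∂μ
  have hY : Measurable Y := hg.sub_const _
  have hsub : ∀ j : Fin m, ProbabilityTheory.HasSubgaussianMGF (fun S : Fin m → α => Y (S j))
      ((‖B - 0‖₊ / 2) ^ 2) P := by
    intro j
    have h1 := ProbabilityTheory.hasSubgaussianMGF_of_mem_Icc (μ := μ) hg.aemeasurable
      (Filter.Eventually.of_forall hgB)
    have hmp : MeasurePreserving (Function.eval j) P μ :=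
      measurePreserving_eval (fun _ : Fin m => μ) j
    rw [← hmp.map_eq] at h1
    have := ProbabilityTheory.HasSubgaussianMGF.of_map hmp.measurable.aemeasurable h1
    rw [hmp.map_eq] at this
    exact this
  have hind : ProbabilityTheory.iIndepFun (fun (j : Fin m) (S : Fin m → α) => Y (S j)) P :=
    ProbabilityTheory.iIndepFun_pi fun _ => hY.aemeasurable
  have hmain := ProbabilityTheory.HasSubgaussianMGF.measure_sum_ge_le_of_iIndepFun hind
    (s := Finset.univ) (fun j _ => hsub j) (ε := m * r) (by positivity)
  rw [← ENNReal.ofReal_toReal (measure_ne_top P _)]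
  refine ENNReal.ofReal_le_ofReal ?_
  have hset : {S : Fin m → α | m * (∫ x, g x ∂μ + r) ≤ ∑ j, g (S j)} =
      {S | m * r ≤ ∑ j, Y (S j)} := by
    ext S
    simp only [Set.mem_ofPred_eq, Y, Finset.sum_sub_distrib, Finset.sum_const, Finset.card_univ,
      Fintype.card_fin, nsmul_eq_mul]
    constructor <;> intro h <;> linarith
  rw [hset]
  refine hmain.trans (Real.exp_le_exp.2 ?_)
  simp only [Finset.sum_const, Finset.card_univ, Fintype.card_fin, nsmul_eq_mul, sub_zero]
  push_cast
  rw [Real.norm_of_nonneg hB.le]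
  rcases Nat.eq_zero_or_pos m with rfl | hm
  · simp
  have : (0 : ℝ) < m := by exact_mod_cast hm
  apply le_of_eq
  field_simp

/-- Uniform one-sided deviation bound from finitely many upper brackets. -/
lemma measure_pi_exists_sum_gt_le {α ι γ : Type*} [MeasurableSpace α] [Fintype γ] (μ : Measure α)
    [IsProbabilityMeasure μ] {T : Set α} (hT : ∀ᵐ x ∂μ, x ∈ T) {f : ι → α → ℝ} {g : γ → α → ℝ}
    (hg : ∀ c, Measurable (g c)) {B r η : ℝ} (hB : 0 < B) (hr : 0 ≤ r)
    (hgB : ∀ c x, g c x ∈ Set.Icc 0 B)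
    (hfg : ∀ a, ∃ c, (∀ x ∈ T, f a x ≤ g c x) ∧ ∫ x, g c x ∂μ ≤ ∫ x, f a x ∂μ + η) (m : ℕ) :
    (Measure.pi fun _ : Fin m => μ) {S | ∃ a, m * (∫ x, f a x ∂μ + η + r) < ∑ j, f a (S j)} ≤
      Fintype.card γ * ENNReal.ofReal (Real.exp (-(2 * m * r ^ 2 / B ^ 2))) := by
  set P := Measure.pi fun _ : Fin m => μ
  have hTP : ∀ᵐ S ∂P, ∀ j, S j ∈ T := by
    rw [ae_all_iff]
    intro j
    exact (measurePreserving_eval (fun _ : Fin m => μ) j).quasiMeasurePreserving.ae hT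
  have hsub : {S : Fin m → α | ∃ a, m * (∫ x, f a x ∂μ + η + r) < ∑ j, f a (S j)} ≤ᵐ[P]
      ⋃ c, {S | m * (∫ x, g c x ∂μ + r) ≤ ∑ j, g c (S j)} := by
    filter_upwards [hTP] with S hS hSa
    obtain ⟨a, ha⟩ := hSa
    obtain ⟨c, hc1, hc2⟩ := hfg a
    refine Set.mem_iUnion.2 ⟨c, ?_⟩
    have h1 : ∑ j, f a (S j) ≤ ∑ j, g c (S j) := Finset.sum_le_sum fun j _ => hc1 _ (hS j)
    have h2 : (m : ℝ) * (∫ x, g c x ∂μ + r) ≤ m * (∫ x, f a x ∂μ + η + r) := by gcongr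
    exact h2.trans (ha.le.trans h1)
  calc P _ ≤ P (⋃ c, {S | m * (∫ x, g c x ∂μ + r) ≤ ∑ j, g c (S j)}) := measure_mono_ae hsub
    _ ≤ ∑ c, P {S | m * (∫ x, g c x ∂μ + r) ≤ ∑ j, g c (S j)} := measure_iUnion_fintype_le _ _
    _ ≤ ∑ _c : γ, ENNReal.ofReal (Real.exp (-(2 * m * r ^ 2 / B ^ 2))) :=
      Finset.sum_le_sum fun c _ => measure_pi_sum_ge_le μ (hg c) hB hr (hgB c) m
    _ = _ := by simp

section Bracket

variable {n t : ℕ} {Φ : Fin t → ℝ} {𝒳 : Finset (Finset (Fin n))}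

lemma levels_eq_of_quantized {κ : Fin n → ℝ → ℕ} (hκ : ∀ i, Monotone (κ i)) {A A' : TLevel n t}
    (hAA' : ∀ i τ, κ i (A.thr i τ) = κ i (A'.thr i τ)) {v : Fin n → ℝ}
    (hv : ∀ i τ, κ i (v i) ≠ κ i (A.thr i τ)) : levels A v = levels A' v := by
  have key : ∀ B : TLevel n t, (∀ i τ, κ i (v i) ≠ κ i (B.thr i τ)) → ∀ i τ,
      (B.thr i τ ≤ v i ↔ κ i (B.thr i τ) < κ i (v i)) := fun B hB i τ =>
    ⟨fun h => (hκ i h).lt_of_ne (hB i τ).symm, fun h => ((hκ i).reflect_lt h).le⟩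
  funext i
  simp only [levels, levCount]
  congr 1
  refine Finset.filter_congr fun τ _ => ?_
  rw [key A hv, key A' (fun i τ => hAA' i τ ▸ hv i τ), hAA']

lemma max_zero_sum_clamp {X : Finset (Fin n)} {p : Fin n → ℝ} {H : ℝ} (hH : 0 ≤ H)
    (hp : ∀ i ∈ X, p i ≤ H) :
    max 0 (∑ i ∈ X, max (-(n * H)) (p i)) = max 0 (∑ i ∈ X, p i) := by
  by_cases h : ∀ i ∈ X, -(n * H) ≤ p i
  · rw [Finset.sum_congr rfl fun i hi => max_eq_right (h i hi)]
  · push Not at h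
    obtain ⟨j, hj, hjlt⟩ := h
    have hn : (0 : ℝ) ≤ n * H := by positivity
    have h1 := sum_le_of_mem_le hH hp hj
    have h2 := sum_le_of_mem_le (a := fun i => max (-(n * H)) (p i)) hH
      (fun i hi => max_le (by linarith) (hp i hi)) hj
    rw [max_eq_left hjlt.le] at h2
    rw [max_eq_left (by linarith), max_eq_left (by linarith)]

lemma max_zero_revX_le (h𝒳 : ∅ ∈ 𝒳) (hΦ : Monotone Φ) {A A' : TLevel n t} {H w : ℝ} (hH : 0 ≤ H)
    (hw : 0 ≤ w) {v : Fin n → ℝ} (hv : ∀ i, v i ∈ Set.Icc 0 H) (hlev : levels A v = levels A' v)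
    (hclose : ∀ i τ, |max (-(n * H)) (min (A.thr i τ) H) -
      max (-(n * H)) (min (A'.thr i τ) H)| ≤ w) :
    max 0 (RevX A Φ 𝒳 tieOrd v) ≤ max 0 (RevX A' Φ 𝒳 tieOrd v) + n * w := by
  have hpay : ∀ B : TLevel n t, ∀ i ∈ chosen Φ 𝒳 (levels B v),
      phiAt (B.thr i) (crit Φ 𝒳 (levels B v) i) ≤ H := by
    intro B i hi
    rw [← selected_eq_chosen] at hi
    rw [← payX_eq h𝒳 hΦ B hi]
    exact (payX_le h𝒳 hΦ B hi).trans (hv i).2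
  have hphi : ∀ i k, |max (-(n * H)) (min (phiAt (A.thr i) k) H) -
      max (-(n * H)) (min (phiAt (A'.thr i) k) H)| ≤ w := by
    intro i k
    simp only [phiAt]
    split_ifs
    · exact hclose i _
    · simpa using hw
  have h1 := hpay A
  have h2 := hpay A'
  rw [revX_eq h𝒳 hΦ, revX_eq h𝒳 hΦ, ← max_zero_sum_clamp hH h1, ← max_zero_sum_clamp hH h2]
  rw [hlev] at h1 ⊢
  have hsum : ∑ i ∈ chosen Φ 𝒳 (levels A' v),
        (max (-(n * H)) (phiAt (A.thr i) (crit Φ 𝒳 (levels A' v) i)) -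
          max (-(n * H)) (phiAt (A'.thr i) (crit Φ 𝒳 (levels A' v) i))) ≤ n * w := by
    refine sum_le_of_le hw fun i hi => ?_
    have := (abs_le.1 (hphi i (crit Φ 𝒳 (levels A' v) i))).2
    rwa [min_eq_left (h1 i hi), min_eq_left (h2 i hi)] at this
  rw [Finset.sum_sub_distrib] at hsum
  have hnw : 0 ≤ n * w := by positivity
  refine max_le (add_nonneg (le_max_left _ _) hnw) ?_
  linarith [le_max_right 0 (∑ i ∈ chosen Φ 𝒳 (levels A' v),
    max (-(n * H)) (phiAt (A'.thr i) (crit Φ 𝒳 (levels A' v) i)))]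

/-- The profiles at which some bid is in the same quantization cell as some threshold. -/
def collisions (κ : Fin n → ℝ → ℕ) (A : TLevel n t) : Set (Fin n → ℝ) :=
  ⋃ i, ⋃ τ, Function.eval i ⁻¹' (κ i ⁻¹' {κ i (A.thr i τ)})

lemma measurableSet_collisions {κ : Fin n → ℝ → ℕ} (hκ : ∀ i, Monotone (κ i)) (A : TLevel n t) :
    MeasurableSet (collisions κ A) :=
  MeasurableSet.iUnion fun i => MeasurableSet.iUnion fun _ =>
    measurable_pi_apply i ((hκ i).measurable (measurableSet_singleton _))

lemma measure_collisions_le {Fi : Fin n → Measure ℝ} [∀ i, IsProbabilityMeasure (Fi i)]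
    {κ : Fin n → ℝ → ℕ} (hκ : ∀ i, Monotone (κ i)) {q : ℝ} (hq : 0 ≤ q)
    (hcell : ∀ i k, Fi i (κ i ⁻¹' {k}) ≤ ENNReal.ofReal q) (A : TLevel n t) :
    (Measure.pi Fi).real (collisions κ A) ≤ n * t * q := by
  refine ENNReal.toReal_le_of_le_ofReal (by positivity) ?_
  calc Measure.pi Fi (collisions κ A)
      ≤ ∑ i, ∑ τ, Measure.pi Fi (Function.eval i ⁻¹' (κ i ⁻¹' {κ i (A.thr i τ)})) :=
        (measure_iUnion_fintype_le _ _).trans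
          (Finset.sum_le_sum fun i _ => measure_iUnion_fintype_le _ _)
    _ ≤ ∑ _i : Fin n, ∑ _τ : Fin t, ENNReal.ofReal q := by
        refine Finset.sum_le_sum fun i _ => Finset.sum_le_sum fun τ _ => ?_
        rw [(measurePreserving_eval Fi i).measure_preimage
          ((hκ i).measurable (measurableSet_singleton _)).nullMeasurableSet]
        exact hcell i _
    _ = ENNReal.ofReal (n * t * q) := by
        simp only [Finset.sum_const, Finset.card_univ, Fintype.card_fin, nsmul_eq_mul]
        rw [ENNReal.ofReal_mul (by positivity), ENNReal.ofReal_mul (by positivity),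
          ENNReal.ofReal_natCast, ENNReal.ofReal_natCast, mul_assoc]

/-- An upper bracket for the truncated revenue of every auction whose quantized thresholds agree
with those of `A`. -/
noncomputable def bracket (Φ : Fin t → ℝ) (𝒳 : Finset (Finset (Fin n))) (κ : Fin n → ℝ → ℕ)
    (H w : ℝ) (A : TLevel n t) (v : Fin n → ℝ) : ℝ :=
  if v ∈ collisions κ A then n * H else min (n * H) (max 0 (RevX A Φ 𝒳 tieOrd v) + n * w)

lemma measurable_bracket (h𝒳 : ∅ ∈ 𝒳) (hΦ : Monotone Φ) {κ : Fin n → ℝ → ℕ}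
    (hκ : ∀ i, Monotone (κ i)) (H w : ℝ) (A : TLevel n t) :
    Measurable (bracket Φ 𝒳 κ H w A) :=
  Measurable.ite (measurableSet_collisions hκ A) measurable_const
    (measurable_const.min ((measurable_const.max (measurable_revX h𝒳 hΦ A)).add_const _))

lemma bracket_mem_Icc (κ : Fin n → ℝ → ℕ) {H w : ℝ} (hH : 0 ≤ H) (hw : 0 ≤ w) (A : TLevel n t)
    (v : Fin n → ℝ) : bracket Φ 𝒳 κ H w A v ∈ Set.Icc 0 (n * H) := by
  have hn : (0 : ℝ) ≤ n * H := by positivity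
  rw [bracket]
  split_ifs
  · exact ⟨hn, le_rfl⟩
  · exact ⟨le_min hn (add_nonneg (le_max_left _ _) (by positivity)), min_le_left _ _⟩

lemma max_zero_revX_mem_Icc (h𝒳 : ∅ ∈ 𝒳) (hΦ : Monotone Φ) (A : TLevel n t) {H : ℝ} (hH : 0 ≤ H)
    {v : Fin n → ℝ} (hv : ∀ i, v i ∈ Set.Icc 0 H) :
    max 0 (RevX A Φ 𝒳 tieOrd v) ∈ Set.Icc 0 (n * H) :=
  ⟨le_max_left _ _, max_le (by positivity) (revX_le h𝒳 hΦ A hH hv)⟩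

variable {κ : Fin n → ℝ → ℕ} {H w : ℝ} {A A' : TLevel n t}

lemma le_bracket (h𝒳 : ∅ ∈ 𝒳) (hΦ : Monotone Φ) (hκ : ∀ i, Monotone (κ i)) (hH : 0 ≤ H)
    (hw : 0 ≤ w)
    (hdiam : ∀ i x y, κ i x = κ i y → |max (-(n * H)) (min x H) - max (-(n * H)) (min y H)| ≤ w)
    (hAA' : ∀ i τ, κ i (A.thr i τ) = κ i (A'.thr i τ)) {v : Fin n → ℝ}
    (hv : ∀ i, v i ∈ Set.Icc 0 H) :
    max 0 (RevX A Φ 𝒳 tieOrd v) ≤ bracket Φ 𝒳 κ H w A' v := by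
  have hle := (max_zero_revX_mem_Icc h𝒳 hΦ A hH hv).2
  rw [bracket]
  split_ifs with hc
  · exact hle
  · refine le_min hle (max_zero_revX_le h𝒳 hΦ hH hw hv
      (levels_eq_of_quantized hκ (fun i τ => (hAA' i τ).symm) ?_).symm
      fun i τ => hdiam i _ _ (hAA' i τ))
    intro i τ h
    exact hc (Set.mem_iUnion₂.2 ⟨i, τ, h⟩)

lemma bracket_le (h𝒳 : ∅ ∈ 𝒳) (hΦ : Monotone Φ) (hκ : ∀ i, Monotone (κ i)) (hH : 0 ≤ H)
    (hw : 0 ≤ w)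
    (hdiam : ∀ i x y, κ i x = κ i y → |max (-(n * H)) (min x H) - max (-(n * H)) (min y H)| ≤ w)
    (hAA' : ∀ i τ, κ i (A.thr i τ) = κ i (A'.thr i τ)) {v : Fin n → ℝ}
    (hv : ∀ i, v i ∈ Set.Icc 0 H) :
    bracket Φ 𝒳 κ H w A' v ≤ max 0 (RevX A Φ 𝒳 tieOrd v) + 2 * (n * w) +
      (collisions κ A').indicator (fun _ => n * H) v := by
  have hnw : 0 ≤ n * w := by positivity
  have h0 := le_max_left 0 (RevX A Φ 𝒳 tieOrd v)
  by_cases hc : v ∈ collisions κ A'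
  · rw [bracket, if_pos hc, Set.indicator_of_mem hc]
    linarith
  · rw [bracket, if_neg hc, Set.indicator_of_notMem hc]
    refine (min_le_right _ _).trans ?_
    have := max_zero_revX_le (A := A') (A' := A) h𝒳 hΦ hH hw hv
      (levels_eq_of_quantized hκ (fun i τ => (hAA' i τ).symm)
        fun i τ h => hc (Set.mem_iUnion₂.2 ⟨i, τ, h⟩))
      fun i τ => hdiam i _ _ (hAA' i τ).symm
    linarith

lemma integrable_max_zero_revX (h𝒳 : ∅ ∈ 𝒳) (hΦ : Monotone Φ) (hH : 0 ≤ H)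
    {Fi : Fin n → Measure ℝ} [∀ i, IsProbabilityMeasure (Fi i)]
    (hFH : ∀ i, Fi i (Set.Icc 0 H) = 1) (A : TLevel n t) :
    Integrable (fun v => max 0 (RevX A Φ 𝒳 tieOrd v)) (Measure.pi Fi) := by
  refine Integrable.of_mem_Icc 0 (n * H)
    (measurable_const.max (measurable_revX h𝒳 hΦ A)).aemeasurable ?_
  filter_upwards [ae_pi_mem_Icc hFH] with v hv using max_zero_revX_mem_Icc h𝒳 hΦ A hH hv

lemma integral_bracket_le (h𝒳 : ∅ ∈ 𝒳) (hΦ : Monotone Φ) (hκ : ∀ i, Monotone (κ i)) (hH : 0 ≤ H)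
    (hw : 0 ≤ w)
    (hdiam : ∀ i x y, κ i x = κ i y → |max (-(n * H)) (min x H) - max (-(n * H)) (min y H)| ≤ w)
    (hAA' : ∀ i τ, κ i (A.thr i τ) = κ i (A'.thr i τ))
    {Fi : Fin n → Measure ℝ} [∀ i, IsProbabilityMeasure (Fi i)]
    (hFH : ∀ i, Fi i (Set.Icc 0 H) = 1) {q : ℝ} (hq : 0 ≤ q)
    (hcell : ∀ i k, Fi i (κ i ⁻¹' {k}) ≤ ENNReal.ofReal q) :
    ∫ v, bracket Φ 𝒳 κ H w A' v ∂Measure.pi Fi ≤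
      ∫ v, max 0 (RevX A Φ 𝒳 tieOrd v) ∂Measure.pi Fi +
        (2 * (n * w) + n * t * q * (n * H)) := by
  have hmeas := measurableSet_collisions hκ A'
  have hint := integrable_max_zero_revX h𝒳 hΦ hH hFH A
  have hint' : Integrable (fun v => max 0 (RevX A Φ 𝒳 tieOrd v) + 2 * (n * w)) (Measure.pi Fi) :=
    hint.add (integrable_const _)
  have hind : Integrable ((collisions κ A').indicator fun _ => (n * H : ℝ)) (Measure.pi Fi) :=
    (integrable_const _).indicator hmeas
  have hn : (0 : ℝ) ≤ n * H := by positivity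
  calc ∫ v, bracket Φ 𝒳 κ H w A' v ∂Measure.pi Fi
      ≤ ∫ v, (max 0 (RevX A Φ 𝒳 tieOrd v) + 2 * (n * w) +
          (collisions κ A').indicator (fun _ => n * H) v) ∂Measure.pi Fi := by
        refine integral_mono_ae (Integrable.of_mem_Icc 0 (n * H)
          (measurable_bracket h𝒳 hΦ hκ H w A').aemeasurable
          (Filter.Eventually.of_forall fun v => bracket_mem_Icc κ hH hw A' v))
          (hint'.add hind) ?_
        filter_upwards [ae_pi_mem_Icc hFH] with v hv using
          bracket_le h𝒳 hΦ hκ hH hw hdiam hAA' hv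
    _ = ∫ v, max 0 (RevX A Φ 𝒳 tieOrd v) ∂Measure.pi Fi +
        (2 * (n * w) + (Measure.pi Fi).real (collisions κ A') * (n * H)) := by
        rw [integral_add hint' hind,
          integral_add hint (integrable_const _), integral_indicator hmeas, setIntegral_const]
        simp [add_assoc]
    _ ≤ _ := by
        gcongr
        exact measure_collisions_le hκ hq hcell A'

/-- Uniform convergence of the truncated revenues of `t`-level auctions. -/
theorem measure_exists_sum_max_zero_revX_gt_le (h𝒳 : ∅ ∈ 𝒳) (hΦ : Monotone Φ) (hn : 0 < n)
    (hH : 0 < H) (hw : 0 < w) {Fi : Fin n → Measure ℝ} [∀ i, IsProbabilityMeasure (Fi i)]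
    (hF : ∀ i, ∀ x : ℝ, Fi i {x} = 0) (hFH : ∀ i, Fi i (Set.Icc 0 H) = 1) {N r : ℝ} (hN : 0 < N)
    (hr : 0 ≤ r) (m : ℕ) :
    (Measure.pi fun _ : Fin m => Measure.pi Fi)
        {S | ∃ A : TLevel n t, m * (∫ v, max 0 (RevX A Φ 𝒳 tieOrd v) ∂Measure.pi Fi +
          (2 * (n * w) + n * t * (1 / N) * (n * H)) + r) <
            ∑ j, max 0 (RevX A Φ 𝒳 tieOrd (S j))} ≤
      ENNReal.ofReal ((N + (n + 1) * H / w + 1) ^ (n * t) *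
        Real.exp (-(2 * m * r ^ 2 / (n * H) ^ 2))) := by
  have hnH : (0 : ℝ) < n * H := by positivity
  choose κ hκ hκle hdiam hcell using fun i =>
    exists_quantizer (Fi i) (hF i) hN hw (show -(n * H) ≤ H by linarith)
  have hx : 0 ≤ N + (H - -(n * H)) / w := by
    have : 0 ≤ (H - -(n * H)) / w := div_nonneg (by linarith) hw.le
    linarith
  let K : ℕ := ⌊N + (H - -(n * H)) / w⌋₊ + 1
  have hK : ∀ i x, κ i x < K := fun i x => Nat.lt_succ_of_le (Nat.le_floor (hκle i x))
  let prof : TLevel n t → Fin n → Fin t → Fin K := fun A i τ => ⟨κ i (A.thr i τ), hK i _⟩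
  let g : (Fin n → Fin t → Fin K) → (Fin n → ℝ) → ℝ := fun c =>
    if h : ∃ A, prof A = c then bracket Φ 𝒳 κ H w h.choose else 0
  have hg : ∀ c, Measurable (g c) := by
    intro c
    simp only [g]
    split_ifs
    · exact measurable_bracket h𝒳 hΦ hκ H w _
    · exact measurable_const
  have hgB : ∀ c v, g c v ∈ Set.Icc 0 (n * H) := by
    intro c v
    simp only [g]
    split_ifs
    · exact bracket_mem_Icc κ hH.le hw.le _ v
    · exact ⟨le_rfl, hnH.le⟩
  refine (measure_pi_exists_sum_gt_le (Measure.pi Fi) (ae_pi_mem_Icc hFH)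
    (f := fun (A : TLevel n t) v => max 0 (RevX A Φ 𝒳 tieOrd v)) hg hnH hr hgB
    (fun A => ⟨prof A, ?_⟩) m).trans ?_
  · have hex : ∃ A', prof A' = prof A := ⟨A, rfl⟩
    have hAA' : ∀ i τ, κ i (A.thr i τ) = κ i (hex.choose.thr i τ) := fun i τ =>
      congrArg Fin.val (congrFun (congrFun hex.choose_spec.symm i) τ)
    have hgA : g (prof A) = bracket Φ 𝒳 κ H w hex.choose := dif_pos hex
    rw [hgA]
    exact ⟨fun v hv => le_bracket h𝒳 hΦ hκ hH.le hw.le hdiam hAA' hv,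
      integral_bracket_le h𝒳 hΦ hκ hH.le hw.le hdiam hAA' hFH (by positivity) hcell⟩
  · rw [← ENNReal.ofReal_natCast, ← ENNReal.ofReal_mul (Nat.cast_nonneg _)]
    refine ENNReal.ofReal_le_ofReal ?_
    gcongr
    simp only [Fintype.card_pi, Fintype.card_fin, Finset.prod_const, Finset.card_univ]
    push_cast
    rw [← pow_mul, mul_comm t n]
    gcongr
    have := Nat.floor_le hx
    simp only [K]
    push_cast
    have e : (n + 1) * H / w = (H - -(n * H)) / w := by ring
    rw [e]
    linarith

end Bracket

section Concentration

variable {n t : ℕ} {Φ : Fin t → ℝ} {𝒳 : Finset (Finset (Fin n))} {H : ℝ}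
  {Fi : Fin n → Measure ℝ} [∀ i, IsProbabilityMeasure (Fi i)]

/-- Lower deviation bound for the truncated revenue of a single `t`-level auction. -/
lemma measure_sum_max_zero_revX_le (h𝒳 : ∅ ∈ 𝒳) (hΦ : Monotone Φ) (hn : 0 < n) (hH : 0 < H)
    (hFH : ∀ i, Fi i (Set.Icc 0 H) = 1) {r : ℝ} (hr : 0 ≤ r) (A : TLevel n t) (m : ℕ) :
    (Measure.pi fun _ : Fin m => Measure.pi Fi) {S | ∑ j, max 0 (RevX A Φ 𝒳 tieOrd (S j)) ≤
        m * (∫ v, max 0 (RevX A Φ 𝒳 tieOrd v) ∂Measure.pi Fi - r)} ≤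
      ENNReal.ofReal (Real.exp (-(2 * m * r ^ 2 / (n * H) ^ 2))) := by
  have hnH : (0 : ℝ) < n * H := by positivity
  let g : (Fin n → ℝ) → ℝ := fun v => n * H - min (n * H) (max 0 (RevX A Φ 𝒳 tieOrd v))
  have hg : Measurable g :=
    measurable_const.sub (measurable_const.min (measurable_const.max (measurable_revX h𝒳 hΦ A)))
  have hgB : ∀ v, g v ∈ Set.Icc 0 (n * H) := fun v =>
    ⟨sub_nonneg.2 (min_le_left _ _), sub_le_self _ (le_min hnH.le (le_max_left _ _))⟩
  have hgv : ∀ v, n * H - max 0 (RevX A Φ 𝒳 tieOrd v) ≤ g v := fun v =>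
    sub_le_sub_left (min_le_right _ _) _
  have hgint : ∫ v, g v ∂Measure.pi Fi =
      n * H - ∫ v, max 0 (RevX A Φ 𝒳 tieOrd v) ∂Measure.pi Fi := by
    have hint := integrable_max_zero_revX h𝒳 hΦ hH.le hFH A
    have : ∫ v, (n * H - max 0 (RevX A Φ 𝒳 tieOrd v)) ∂Measure.pi Fi =
        n * H - ∫ v, max 0 (RevX A Φ 𝒳 tieOrd v) ∂Measure.pi Fi := by
      rw [integral_sub (integrable_const _) hint]
      simp
    rw [← this]
    refine integral_congr_ae ?_
    filter_upwards [ae_pi_mem_Icc hFH] with v hv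
    simp only [g]
    rw [min_eq_right (max_zero_revX_mem_Icc h𝒳 hΦ A hH.le hv).2]
  refine (measure_mono fun S hS => ?_).trans (measure_pi_sum_ge_le _ hg hnH hr hgB m)
  simp only [Set.mem_ofPred_eq] at hS ⊢
  have h1 := Finset.sum_le_sum fun j (_ : j ∈ Finset.univ) => hgv (S j)
  rw [Finset.sum_sub_distrib] at h1
  simp only [Finset.sum_const, Finset.card_univ, Fintype.card_fin, nsmul_eq_mul] at h1
  rw [hgint]
  linarith

/-- If the bracketing failure probability is at most `δ`, then with probability at least `1 - δ`
every empirical maximizer competes with any fixed auction of nonnegative thresholds. -/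
theorem le_measure_forall_maximizer (h𝒳 : ∅ ∈ 𝒳) (hΦ : Monotone Φ) (hn : 0 < n)
    (hH : 0 < H) (hF : ∀ i, ∀ x : ℝ, Fi i {x} = 0) (hFH : ∀ i, Fi i (Set.Icc 0 H) = 1)
    {w N r η δ : ℝ} (hw : 0 < w) (hN : 0 < N) (hr : 0 ≤ r) {m : ℕ} {A₀ : TLevel n t}
    (hA₀ : ∀ i τ, 0 ≤ A₀.thr i τ)
    (hη : 2 * (n * w) + n * t * (1 / N) * (n * H) + 2 * r ≤ η)
    (hδ : ((N + (n + 1) * H / w + 1) ^ (n * t) + 1) *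
      Real.exp (-(2 * m * r ^ 2 / (n * H) ^ 2)) ≤ δ) {O : ℝ≥0∞} {β : ℝ} (hβ : 0 ≤ η + β)
    (hO : O ≤ ENNReal.ofReal (∫ v, RevX A₀ Φ 𝒳 tieOrd v ∂Measure.pi Fi + β)) :
    ENNReal.ofReal (1 - δ) ≤ (Measure.pi fun _ : Fin m => Measure.pi Fi)
      {S | ∀ Ahat : TLevel n t,
        (∀ A : TLevel n t,
          (∑ j, RevX A Φ 𝒳 tieOrd (S j)) ≤ ∑ j, RevX Ahat Φ 𝒳 tieOrd (S j)) →
        O ≤ (∫⁻ v, ENNReal.ofReal (RevX Ahat Φ 𝒳 tieOrd v) ∂(Measure.pi Fi)) +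
          ENNReal.ofReal (η + β)} := by
  have hrev₀ : ∀ v, max 0 (RevX A₀ Φ 𝒳 tieOrd v) = RevX A₀ Φ 𝒳 tieOrd v := fun v => by
    refine max_eq_right ?_
    rw [revX_eq h𝒳 hΦ]
    exact Finset.sum_nonneg fun i _ => phiAt_nonneg (hA₀ i) _
  set P := Measure.pi fun _ : Fin m => Measure.pi Fi
  set E₁ : Set (Fin m → Fin n → ℝ) :=
    {S | ∃ A : TLevel n t, m * (∫ v, max 0 (RevX A Φ 𝒳 tieOrd v) ∂Measure.pi Fi +
      (2 * (n * w) + n * t * (1 / N) * (n * H)) + r) < ∑ j, max 0 (RevX A Φ 𝒳 tieOrd (S j))}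
    with hE₁
  set E₂ : Set (Fin m → Fin n → ℝ) := {S | ∑ j, max 0 (RevX A₀ Φ 𝒳 tieOrd (S j)) ≤
    m * (∫ v, max 0 (RevX A₀ Φ 𝒳 tieOrd v) ∂Measure.pi Fi - r)} with hE₂
  set G : Set (Fin m → Fin n → ℝ) := {S | ∀ Ahat : TLevel n t,
    (∀ A : TLevel n t,
      (∑ j, RevX A Φ 𝒳 tieOrd (S j)) ≤ ∑ j, RevX Ahat Φ 𝒳 tieOrd (S j)) →
    O ≤ (∫⁻ v, ENNReal.ofReal (RevX Ahat Φ 𝒳 tieOrd v) ∂(Measure.pi Fi)) +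
      ENNReal.ofReal (η + β)} with hG
  have hcover : Set.univ ⊆ G ∪ (E₁ ∪ E₂) := by
    intro S _
    by_contra hS
    simp only [Set.mem_union, not_or] at hS
    obtain ⟨hSG, hS₁, hS₂⟩ := hS
    refine hSG fun Ahat hA => ?_
    simp only [hE₁, hE₂, Set.mem_ofPred_eq, not_exists, not_lt, not_le] at hS₁ hS₂
    have h1 := hS₁ Ahat
    have h2 : ∑ j, RevX Ahat Φ 𝒳 tieOrd (S j) ≤ ∑ j, max 0 (RevX Ahat Φ 𝒳 tieOrd (S j)) :=
      Finset.sum_le_sum fun _ _ => le_max_right _ _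
    simp_rw [hrev₀] at hS₂
    have h3 := lt_of_mul_lt_mul_left (hS₂.trans_le ((hA A₀).trans (h2.trans h1)))
      (Nat.cast_nonneg m)
    have h4 : ∫⁻ v, ENNReal.ofReal (RevX Ahat Φ 𝒳 tieOrd v) ∂Measure.pi Fi =
        ENNReal.ofReal (∫ v, max 0 (RevX Ahat Φ 𝒳 tieOrd v) ∂Measure.pi Fi) := by
      rw [ofReal_integral_eq_lintegral_ofReal (integrable_max_zero_revX h𝒳 hΦ hH.le hFH Ahat)
        (Filter.Eventually.of_forall fun v => le_max_left _ _)]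
      simp [ENNReal.ofReal_max]
    have h5 : 0 ≤ ∫ v, max 0 (RevX Ahat Φ 𝒳 tieOrd v) ∂Measure.pi Fi :=
      integral_nonneg fun v => le_max_left _ _
    rw [h4, ← ENNReal.ofReal_add h5 hβ]
    refine hO.trans (ENNReal.ofReal_le_ofReal ?_)
    linarith
  have hnH : (0 : ℝ) < n * H := by positivity
  have hb₁ : P E₁ ≤ _ :=
    measure_exists_sum_max_zero_revX_gt_le (t := t) h𝒳 hΦ hn hH hw hF hFH hN hr m
  have hb₂ : P E₂ ≤ _ := measure_sum_max_zero_revX_le h𝒳 hΦ hn hH hFH hr A₀ m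
  have htotal : 1 ≤ P G + ENNReal.ofReal δ := by
    calc 1 = P Set.univ := measure_univ.symm
      _ ≤ P G + (P E₁ + P E₂) := (measure_mono hcover).trans
          ((measure_union_le _ _).trans (add_le_add le_rfl (measure_union_le _ _)))
      _ ≤ _ := by
        gcongr
        refine (add_le_add hb₁ hb₂).trans ?_
        rw [← ENNReal.ofReal_add (by positivity) (by positivity)]
        refine ENNReal.ofReal_le_ofReal ?_
        linarith
  have hδ0 : 0 ≤ δ := le_trans (by positivity) hδ
  rw [ENNReal.ofReal_sub _ hδ0, ENNReal.ofReal_one]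
  exact tsub_le_iff_right.2 htotal

end Concentration

/-- The sample size makes the failure probability of the bracketing bound at most `δ`. -/
lemma failure_probability_le {n t m : ℕ} (hn : 1 ≤ n) (ht : 1 ≤ t) {x δ : ℝ} (hx : 0 < x)
    (hδ : 0 < δ)
    (hm : 108 * x ^ 2 * (n * t * Real.log (n * t + 2) * (1 + Real.log (x + 1)) +
      Real.log (1 / δ)) ≤ m) (hδ1 : δ < 1) :
    ((12 * n * t * x + 24 * (n + 1) * x + 1) ^ (n * t) + 1) *
      Real.exp (-(m / (18 * x ^ 2))) ≤ δ := by
  have hn' : (1 : ℝ) ≤ n := by exact_mod_cast hn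
  have ht' : (1 : ℝ) ≤ t := by exact_mod_cast ht
  have hnt : (n : ℝ) ≤ n * t := le_mul_of_one_le_right (by linarith) ht'
  set y : ℝ := n * t with hy
  have hy1 : 1 ≤ y := hn'.trans hnt
  set K : ℝ := 12 * n * t * x + 24 * (n + 1) * x + 1 with hK
  have hK1 : 1 ≤ K := by
    have : 0 ≤ 12 * n * t * x + 24 * (n + 1) * x := by positivity
    linarith
  have hKle : 2 * K ≤ 120 * (y + 2) * (x + 1) := by
    have h1 : 12 * n * t * x = 12 * (y * x) := by rw [hy]; ring
    have h2 : (n + 1) * x ≤ 2 * y * x := by gcongr; linarith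
    nlinarith
  have hL : 1 ≤ Real.log (y + 2) := by
    rw [Real.le_log_iff_exp_le (by linarith)]
    linarith [Real.exp_one_lt_d9]
  have hlx : 0 ≤ Real.log (x + 1) := Real.log_nonneg (by linarith)
  have hlog : Real.log (2 * K) ≤ 6 * (Real.log (y + 2) * (1 + Real.log (x + 1))) := by
    have h120 : Real.log 120 ≤ 5 := by
      rw [Real.log_le_iff_le_exp (by norm_num)]
      have := Real.exp_one_gt_d9
      calc (120 : ℝ) ≤ 2.7 ^ 5 := by norm_num
        _ ≤ Real.exp 1 ^ 5 := by gcongr; linarith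
        _ = Real.exp 5 := by rw [← Real.exp_nat_mul]; norm_num
    calc Real.log (2 * K) ≤ Real.log (120 * (y + 2) * (x + 1)) :=
          Real.log_le_log (by linarith) hKle
      _ = Real.log 120 + Real.log (y + 2) + Real.log (x + 1) := by
          rw [Real.log_mul (by positivity) (by positivity),
            Real.log_mul (by positivity) (by positivity)]
      _ ≤ _ := by nlinarith
  have hexp : (n * t : ℕ) * Real.log (2 * K) + Real.log (1 / δ) ≤ m / (18 * x ^ 2) := by
    rw [le_div_iff₀ (by positivity)]
    have h0 : 0 ≤ Real.log (1 / δ) := Real.log_nonneg (by rw [le_div_iff₀ hδ]; linarith)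
    have h1 : (n * t : ℕ) * Real.log (2 * K) ≤
        6 * (y * Real.log (y + 2) * (1 + Real.log (x + 1))) := by
      have := mul_le_mul_of_nonneg_left hlog (by linarith : 0 ≤ y)
      push_cast
      linarith
    have h2 : ((n * t : ℕ) * Real.log (2 * K) + Real.log (1 / δ)) * (18 * x ^ 2) ≤
        (6 * (y * Real.log (y + 2) * (1 + Real.log (x + 1))) + 6 * Real.log (1 / δ)) *
          (18 * x ^ 2) := by
      gcongr
      linarith
    linarith
  have hpow : K ^ (n * t) + 1 ≤ (2 * K) ^ (n * t) := by
    have h1 : (1 : ℝ) ≤ K ^ (n * t) := one_le_pow₀ hK1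
    have h2 : (2 : ℝ) ≤ 2 ^ (n * t) :=
      le_self_pow₀ (by norm_num) (Nat.mul_ne_zero (by omega) (by omega))
    rw [mul_pow]
    nlinarith
  calc (K ^ (n * t) + 1) * Real.exp (-(m / (18 * x ^ 2)))
      ≤ (2 * K) ^ (n * t) * Real.exp (-((n * t : ℕ) * Real.log (2 * K) + Real.log (1 / δ))) := by
        gcongr
    _ = δ := by
        have e : (2 * K) ^ (n * t) = Real.exp ((n * t : ℕ) * Real.log (2 * K)) := by
          rw [Real.exp_nat_mul, Real.exp_log (by linarith)]
        rw [e, ← Real.exp_add, one_div, Real.log_inv]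
        rw [show ((n * t : ℕ) : ℝ) * Real.log (2 * K) +
          -((n * t : ℕ) * Real.log (2 * K) + -Real.log δ) = Real.log δ by ring, Real.exp_log hδ]

/-- Sample complexity of learning a near-optimal auction in arbitrary single-parameter
settings with `∅` feasible: there are universal constants `c₁, c₂ > 0` such that for
valuations from a product distribution with atomless marginals supported in `[0,H]`,
there are `t ≤ c₁·H·n²/ε`, estimates `Φ`, and a tie-breaking order such that for every
`m ≥ c₂ (Hn/ε)² (n t ln(nt+2)(1 + ln(Hn/ε + 1)) + ln(1/δ))`, with probability at least
`1 - δ` over `m` i.i.d. samples, every empirical-revenue-maximizing `t`-level auction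
obtains expected revenue within an additive `ε` of optimal. -/
theorem sample_complexity_tlevel_single_parameter :
    ∃ c₁ c₂ : ℝ, 0 < c₁ ∧ 0 < c₂ ∧
      ∀ n : ℕ, 1 ≤ n →
      ∀ H : ℝ, 0 < H →
      ∀ ε δ : ℝ, ε ∈ Set.Ioo (0 : ℝ) 1 → δ ∈ Set.Ioo (0 : ℝ) 1 →
      ∀ 𝒳 : Finset (Finset (Fin n)), ∅ ∈ 𝒳 →
      ∀ Fi : Fin n → Measure ℝ,
        (∀ i, IsProbabilityMeasure (Fi i)) →
        (∀ i, ∀ x : ℝ, Fi i {x} = 0) →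
        (∀ i, Fi i (Set.Icc 0 H) = 1) →
      ∃ (t : ℕ) (Φ : Fin t → ℝ) (ord : Finset (Fin n) → Finset (Fin n) → Prop),
        (t : ℝ) ≤ c₁ * H * n ^ 2 / ε ∧ Monotone Φ ∧ StrictTotalOn 𝒳 ord ∧
        ∀ m : ℕ,
          c₂ * (H * n / ε) ^ 2 *
              (n * t * Real.log (n * t + 2) * (1 + Real.log (H * n / ε + 1)) +
                Real.log (1 / δ))
            ≤ m →
          ENNReal.ofReal (1 - δ) ≤
            (Measure.pi fun _ : Fin m => Measure.pi Fi)
              {S | ∀ Ahat : TLevel n t,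
                (∀ A : TLevel n t,
                  (∑ j, RevX A Φ 𝒳 ord (S j)) ≤ ∑ j, RevX Ahat Φ 𝒳 ord (S j)) →
                OPTX n 𝒳 (Set.Icc 0 H) (Measure.pi Fi) ≤
                  (∫⁻ v, ENNReal.ofReal (RevX Ahat Φ 𝒳 ord v) ∂(Measure.pi Fi)) +
                    ENNReal.ofReal ε} := by
  refine ⟨7, 108, by norm_num, by norm_num, ?_⟩
  intro n hn H hH ε δ hε hδ 𝒳 h𝒳 Fi hFi hF hFH
  have hε0 : 0 < ε := hε.1
  have hn' : (1 : ℝ) ≤ n := by exact_mod_cast hn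
  rcases lt_or_ge (n ^ 2 * H) ε with hsmall | hbig
  · refine ⟨0, fun _ => 0, tieOrd, by push_cast; positivity, monotone_const,
      strictTotalOn_tieOrd 𝒳, fun m _ => ?_⟩
    have hopt : OPTX n 𝒳 (Set.Icc 0 H) (Measure.pi Fi) ≤ ENNReal.ofReal ε :=
      (optX_le_mul hH.le hFH).trans (ENNReal.ofReal_le_ofReal (by nlinarith))
    refine le_trans ?_ (measure_univ.symm.le.trans
      (measure_mono fun S _ Ahat _ => hopt.trans le_add_self))
    exact ENNReal.ofReal_le_one.2 (by linarith [hδ.1])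
  set s : ℝ := ε / (3 * n) with hs
  have hs0 : 0 < s := by positivity
  set t : ℕ := ⌈(n + 1) * H / s⌉₊ with ht
  have ht1 : 1 ≤ t := Nat.ceil_pos.2 (by positivity)
  have ht' : (1 : ℝ) ≤ t := by exact_mod_cast ht1
  have hst : (n + 1) * H ≤ s * t := by
    have := Nat.le_ceil ((n + 1) * H / s)
    rwa [← ht, div_le_iff₀ hs0, mul_comm (t : ℝ)] at this
  have hst' : s * (t - 1) ≤ (n + 1) * H := by
    have := Nat.ceil_lt_add_one (show 0 ≤ (n + 1) * H / s by positivity)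
    rw [← ht, ← sub_lt_iff_lt_add, lt_div_iff₀ hs0] at this
    linarith
  have hΦ : Monotone (gridPhi t (-(n * H)) s) := monotone_gridPhi hs0.le
  have hΦH : ∀ τ, gridPhi t (-(n * H)) s τ ≤ H := by
    intro τ
    have h1 : ((τ : ℕ) : ℝ) ≤ t - 1 := by
      have : ((τ : ℕ) : ℝ) + 1 ≤ t := by exact_mod_cast τ.2
      linarith
    have h2 := mul_le_mul_of_nonneg_left h1 hs0.le
    rw [gridPhi]
    linarith
  refine ⟨t, gridPhi t (-(n * H)) s, tieOrd, ?_, hΦ, strictTotalOn_tieOrd 𝒳, fun m hm => ?_⟩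
  · have h1 := Nat.ceil_lt_add_one (show 0 ≤ (n + 1) * H / s by positivity)
    rw [← ht] at h1
    have h2 : (n + 1) * H / s = 3 * n * (n + 1) * H / ε := by
      rw [hs]
      field_simp
    rw [h2] at h1
    refine h1.le.trans ?_
    rw [le_div_iff₀ hε0, add_mul, div_mul_cancel₀ _ hε0.ne']
    nlinarith
  obtain ⟨A₀, ℓ, hA₀⟩ := exists_isOptimalPricing t hF (-(n * H)) hH.le hs0.le
  have hopt := hA₀.optX_le h𝒳 hH hs0.le ht1 hΦH (by linarith) hF hFH
  have hx : 0 < H * n / ε := by positivity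
  have hfail := failure_probability_le hn ht1 hx hδ.1 hm hδ.2
  have hsum : 2 * ε / 3 + n * s = ε := by
    rw [hs]
    field_simp
    ring
  have hη : 2 * (n * (ε / (24 * n))) + n * t * (1 / (12 * n * t * (H * n / ε))) * (n * H) +
      2 * (ε / 6) ≤ 2 * ε / 3 := by
    have : 2 * (n * (ε / (24 * n))) + n * t * (1 / (12 * n * t * (H * n / ε))) * (n * H) +
        2 * (ε / 6) = ε / 2 := by
      field_simp
      ring
    linarith
  have hbase : (n + 1) * H / (ε / (24 * n)) = 24 * (n + 1) * (H * n / ε) := by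
    field_simp
  have hexponent : 2 * m * (ε / 6) ^ 2 / (n * H) ^ 2 = m / (18 * (H * n / ε) ^ 2) := by
    field_simp
    ring
  rw [← hbase, ← hexponent] at hfail
  have := le_measure_forall_maximizer (r := ε / 6) h𝒳 hΦ hn hH hF hFH (by positivity)
    (by positivity) (by positivity) hA₀.thr_nonneg hη hfail (by rw [hsum]; exact hε0.le) hopt
  rwa [hsum] at this
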